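/- arXiv:1804.00767 — 2 statements merged into one kernel-verified Lean document; each statement's English description precedes it below -/
import Mathlib

section
/- Let K = k₀(∛θ) be a cubic Kummer extension of k₀ = ℚ(ζ₃) with cube-free radicand θ = λ^{e_λ}·ζ₃^{e_ζ}·π₁^{e₁}···π_g^{e_g}, where 0 ≤ e_λ, e_ζ ≤ 2, g ≥ 0, the π_i are pairwise non-associate prime elements of ℤ[ζ₃] with π_i ≡ 1 (mod 3ℤ[ζ₃]), and 1 ≤ e_i ≤ 2 for 1 ≤ i ≤ g. Then there exists Z ∈ K^× with N_{K/k₀}(Z) = ζ₃ if and only if π_i ≡ 1 (mod λ³) in ℤ[ζ₃] for all 1 ≤ i ≤ g; equivalently, ζ₃ is not a relative norm from K^× if and only if π_i ≡ 4 or 7 (mod λ³) for some i. -/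
open IntermediateField NumberField
open scoped nonZeroDivisors

set_option synthInstance.maxHeartbeats 1000000
set_option maxHeartbeats 2000000

noncomputable section

/-- The primitive cube root of unity `ζ₃ = e^{2πi/3}`. -/
def zeta3 : ℂ := Complex.exp (2 * Real.pi * Complex.I / 3)

lemma zeta3_isPrimitiveRoot : IsPrimitiveRoot zeta3 3 := by
  simpa [zeta3] using Complex.isPrimitiveRoot_exp 3 (by norm_num)

lemma isIntegral_zeta3 : IsIntegral ℚ zeta3 :=
  (zeta3_isPrimitiveRoot.isIntegral (by norm_num)).tower_top

/-- `k₀ = ℚ(ζ₃)`, realized as a subfield of `ℂ`. -/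
def k0c : IntermediateField ℚ ℂ := ℚ⟮zeta3⟯

instance : NumberField k0c where
  to_finiteDimensional := by
    apply IntermediateField.finiteDimensional_adjoin
    rintro x rfl
    exact isIntegral_zeta3

/-- `ζ₃` as an element of `k₀ = ℚ(ζ₃)`. -/
def zetaE : ↥k0c := ⟨zeta3, IntermediateField.mem_adjoin_simple_self ℚ zeta3⟩

lemma isIntegral_zetaE : IsIntegral ℤ zetaE := by
  have h : algebraMap ↥k0c ℂ zetaE = zeta3 := rfl
  rw [← isIntegral_algebraMap_iff (algebraMap ↥k0c ℂ).injective, h]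
  exact zeta3_isPrimitiveRoot.isIntegral (by norm_num)

/-- `ζ₃` as an element of the ring of Eisenstein integers `ℤ[ζ₃] = 𝓞(ℚ(ζ₃))`. -/
def zetaO : 𝓞 k0c := ⟨zetaE, isIntegral_zetaE⟩

/-- `λ = 1 - ζ₃`, the prime element of `ℤ[ζ₃]` above `3`. -/
def lamO : 𝓞 k0c := 1 - zetaO

/-- In a cubic extension, the powers `1, α, α²` of a cube root `α` of a non-cube form a basis. -/
lemma exists_basis_pow_of_cube_eq {k F : Type*} [Field k] [Field F] [Algebra k F]
    {a : k} {α : F} (hα : α ^ 3 = algebraMap k F a) (ha : ∀ y : k, y ^ 3 ≠ a)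
    (hF : Module.finrank k F = 3) :
    ∃ b : Module.Basis (Fin 3) k F, ∀ i, b i = α ^ (i : ℕ) := by
  have hmin : Polynomial.X ^ 3 - Polynomial.C a = minpoly k α := by
    refine minpoly.eq_of_irreducible_of_monic
      (X_pow_sub_C_irreducible_of_prime Nat.prime_three ha) ?_
      (Polynomial.monic_X_pow_sub_C a (by norm_num))
    simp [hα]
  have hdeg : (minpoly k α).natDegree = 3 := by
    rw [← hmin, Polynomial.natDegree_X_pow_sub_C]
  have hli : LinearIndependent k fun i : Fin 3 => α ^ (i : ℕ) := by
    have h := linearIndependent_pow (K := k) α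
    rw [hdeg] at h
    exact h
  exact ⟨basisOfLinearIndependentOfCardEqFinrank hli (by simp [hF]), by simp⟩

/-- The matrix of multiplication by an element of a pure cubic extension. -/
lemma exists_leftMulMatrix_of_cube_eq {k F : Type*} [Field k] [Field F] [Algebra k F]
    {a : k} {α : F} (hα : α ^ 3 = algebraMap k F a) (ha : ∀ y : k, y ^ 3 ≠ a)
    (hF : Module.finrank k F = 3) :
    ∃ b : Module.Basis (Fin 3) k F, ∀ p q r : k, Algebra.leftMulMatrix b
      (algebraMap k F p + algebraMap k F q * α + algebraMap k F r * α ^ 2) =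
      !![p, a * r, a * q; q, p, a * r; r, q, p] := by
  obtain ⟨b, hb⟩ := exists_basis_pow_of_cube_eq hα ha hF
  refine ⟨b, fun p q r => ?_⟩
  ext i j
  rw [Algebra.leftMulMatrix_eq_repr_mul]
  have key : (algebraMap k F p + algebraMap k F q * α + algebraMap k F r * α ^ 2) * b j =
      ∑ l, (!![p, a * r, a * q; q, p, a * r; r, q, p] : Matrix (Fin 3) (Fin 3) k) l j • b l := by
    simp only [hb, Fin.sum_univ_three, Algebra.smul_def]
    fin_cases j
    · simp
    · simp only [Fin.mk_one, Fin.isValue, Fin.val_one, pow_one, Matrix.of_apply, Matrix.cons_val',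
        Matrix.cons_val_one, Matrix.cons_val_fin_one, Matrix.cons_val_zero, Matrix.cons_val,
        map_mul, Fin.val_zero, pow_zero, Fin.val_two, ← hα]
      ring
    · simp only [Fin.reduceFinMk, Fin.isValue, Fin.val_one, pow_one, Matrix.of_apply,
        Matrix.cons_val',
        Matrix.cons_val_one, Matrix.cons_val_fin_one, Matrix.cons_val_zero, Matrix.cons_val,
        map_mul, Fin.val_zero, pow_zero, Fin.val_two, ← hα]
      ring
  rw [key]
  simp [Finsupp.single_apply]

/-- The norm form of a pure cubic extension. -/
lemma norm_add_mul_add_mul_sq {k F : Type*} [Field k] [Field F] [Algebra k F]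
    {a : k} {α : F} (hα : α ^ 3 = algebraMap k F a) (ha : ∀ y : k, y ^ 3 ≠ a)
    (hF : Module.finrank k F = 3) (p q r : k) :
    Algebra.norm k (algebraMap k F p + algebraMap k F q * α + algebraMap k F r * α ^ 2) =
      p ^ 3 + a * q ^ 3 + a ^ 2 * r ^ 3 - 3 * a * p * q * r := by
  obtain ⟨b, hM⟩ := exists_leftMulMatrix_of_cube_eq hα ha hF
  rw [Algebra.norm_eq_matrix_det b, hM, Matrix.det_fin_three]
  simp
  ring

lemma trace_add_mul_add_mul_sq {k F : Type*} [Field k] [Field F] [Algebra k F]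
    {a : k} {α : F} (hα : α ^ 3 = algebraMap k F a) (ha : ∀ y : k, y ^ 3 ≠ a)
    (hF : Module.finrank k F = 3) (p q r : k) :
    Algebra.trace k F (algebraMap k F p + algebraMap k F q * α + algebraMap k F r * α ^ 2) =
      3 * p := by
  obtain ⟨b, hM⟩ := exists_leftMulMatrix_of_cube_eq hα ha hF
  rw [Algebra.trace_eq_matrix_trace b, hM, Matrix.trace_fin_three]
  simp
  ring

/-- Every element of a pure cubic extension is a quadratic polynomial in the generator. -/
lemma exists_eq_add_mul_add_mul_sq {k F : Type*} [Field k] [Field F] [Algebra k F]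
    {a : k} {α : F} (hα : α ^ 3 = algebraMap k F a) (ha : ∀ y : k, y ^ 3 ≠ a)
    (hF : Module.finrank k F = 3) (x : F) :
    ∃ p q r : k, x = algebraMap k F p + algebraMap k F q * α + algebraMap k F r * α ^ 2 := by
  obtain ⟨b, hb⟩ := exists_basis_pow_of_cube_eq hα ha hF
  refine ⟨b.repr x 0, b.repr x 1, b.repr x 2, ?_⟩
  conv_lhs => rw [← b.sum_repr x]
  simp [Fin.sum_univ_three, hb, Algebra.smul_def]

/-- The norm symbol is symmetric: if `a` is a value of the norm form of `k(∛ω)`, for `ω` a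
primitive cube root of unity, then `ω` is a norm from `k(∛a)`. -/
lemma exists_norm_eq_of_eq_norm_form {k F : Type*} [Field k] [Field F] [Algebra k F]
    {a ω : k} {α : F} (hω : ω ^ 2 + ω + 1 = 0)
    (hα : α ^ 3 = algebraMap k F a) (ha : ∀ y : k, y ^ 3 ≠ a)
    (hF : Module.finrank k F = 3) {p q r : k}
    (h : a = p ^ 3 + ω * q ^ 3 + ω ^ 2 * r ^ 3 - 3 * ω * p * q * r) :
    ∃ Z : F, Z ≠ 0 ∧ Algebra.norm k Z = ω := by
  have : FiniteDimensional k F := Module.finite_of_finrank_pos (by omega)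
  have hω3 : ω ^ 3 = 1 := by linear_combination (ω - 1) * hω
  have hω0 : ω ≠ 0 := by rintro rfl; simp at hω3
  set w₀ : F := algebraMap k F (p ^ 2 - ω * q * r) + algebraMap k F p * α +
    algebraMap k F 1 * α ^ 2 with hw₀
  set w₂ : F := algebraMap k F (q ^ 2 - p * r) + algebraMap k F (ω * r) * α +
    algebraMap k F 0 * α ^ 2 with hw₂
  have hw₀0 : w₀ ≠ 0 := by
    obtain ⟨b, hb⟩ := exists_basis_pow_of_cube_eq hα ha hF
    intro h0
    have hrep : ∑ i, (![p ^ 2 - ω * q * r, p, 1] : Fin 3 → k) i • b i = 0 := by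
      rw [← h0, hw₀]
      simp [Fin.sum_univ_three, hb, Algebra.smul_def]
    have := Fintype.linearIndependent_iff.mp b.linearIndependent _ hrep 2
    simp at this
  have hn0 := norm_add_mul_add_mul_sq hα ha hF (p ^ 2 - ω * q * r) p 1
  have hn2 := norm_add_mul_add_mul_sq hα ha hF (q ^ 2 - p * r) (ω * r) 0
  rw [← hw₀] at hn0
  rw [← hw₂] at hn2
  have hne : Algebra.norm k w₀ ≠ 0 := Algebra.norm_ne_zero_iff.mpr hw₀0
  have hrel : Algebra.norm k w₂ = ω * Algebra.norm k w₀ := by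
    rw [hn0, hn2, h]
    linear_combination (1 - ω) * (q ^ 2 - p * r) ^ 3 * hω
  have hN : Algebra.norm k (w₂ / w₀) = ω := by
    have h1 : Algebra.norm k (w₂ / w₀) * Algebra.norm k w₀ = Algebra.norm k w₂ := by
      rw [← map_mul, div_mul_cancel₀ _ hw₀0]
    exact mul_right_cancel₀ hne (h1.trans hrel)
  refine ⟨w₂ / w₀, ?_, hN⟩
  intro h0
  rw [h0, Algebra.norm_zero] at hN
  exact hω0 hN.symm

/-- If `c` is represented by the norm form of the cube root of `π u` over the fraction field, where
the prime `π` does not divide `u`, then `c` is a cube modulo `π`. -/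
lemma exists_dvd_mul_cube_sub_cube {R : Type*} [CommRing R] [IsDomain R] [WfDvdMonoid R]
    {π u c d x y w : R} (hπ : Prime π) (hu : ¬ π ∣ u) (hd : d ≠ 0)
    (h : c * d ^ 3 = x ^ 3 + π * u * y ^ 3 + (π * u) ^ 2 * w ^ 3 - 3 * (π * u) * x * y * w) :
    ∃ s t : R, ¬ π ∣ s ∧ π ∣ c * s ^ 3 - t ^ 3 := by
  obtain ⟨n, d', hd', rfl⟩ := WfDvdMonoid.max_power_factor hd hπ.irreducible
  clear hd
  induction n generalizing x y w with
  | zero =>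
    refine ⟨d', x, hd', u * y ^ 3 + π * u ^ 2 * w ^ 3 - 3 * u * x * y * w, ?_⟩
    linear_combination h
  | succ n ih =>
    have hx : π ∣ x := by
      refine hπ.dvd_of_dvd_pow (n := 3) ⟨c * π ^ 2 * (π ^ n * d') ^ 3 -
        (u * y ^ 3 + π * u ^ 2 * w ^ 3 - 3 * u * x * y * w), ?_⟩
      linear_combination -h
    obtain ⟨x, rfl⟩ := hx
    have hy : π ∣ y := by
      have : π ∣ u * y ^ 3 := by
        refine ⟨c * π * (π ^ n * d') ^ 3 - (π * x ^ 3 + u ^ 2 * w ^ 3 - 3 * u * x * y * w), ?_⟩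
        refine mul_left_cancel₀ hπ.ne_zero ?_
        linear_combination -h
      exact hπ.dvd_of_dvd_pow ((hπ.dvd_or_dvd this).resolve_left hu)
    obtain ⟨y, rfl⟩ := hy
    have hw : π ∣ w := by
      have : π ∣ u ^ 2 * w ^ 3 := by
        refine ⟨c * (π ^ n * d') ^ 3 - (x ^ 3 + π * u * y ^ 3 - 3 * u * x * y * w), ?_⟩
        refine mul_left_cancel₀ (pow_ne_zero 2 hπ.ne_zero) ?_
        linear_combination -h
      exact hπ.dvd_of_dvd_pow ((hπ.dvd_or_dvd this).resolve_left
        fun h => hu (hπ.dvd_of_dvd_pow h))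
    obtain ⟨w, rfl⟩ := hw
    refine ih (x := x) (y := y) (w := w) (mul_left_cancel₀ (pow_ne_zero 3 hπ.ne_zero) ?_)
    linear_combination h

/-- A primitive cube root of unity of a finite field is a cube iff the field has order congruent
to `1` modulo `9`. -/
lemma exists_cube_eq_iff_nine_dvd {κ : Type*} [Field κ] [Finite κ] {ω : κ}
    (hω : IsPrimitiveRoot ω 3) : (∃ t, t ^ 3 = ω) ↔ 9 ∣ Nat.card κ - 1 := by
  have hcard : Nat.card κˣ = Nat.card κ - 1 := Nat.card_units κ
  rw [← hcard]
  have hω0 : ω ≠ 0 := hω.ne_zero (by norm_num)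
  constructor
  · rintro ⟨t, rfl⟩
    have ht : t ≠ 0 := by rintro rfl; simp at hω0
    have h9 : orderOf (Units.mk0 t ht) = 3 ^ (1 + 1) := by
      refine orderOf_eq_prime_pow ?_ ?_
      · intro h
        have h' : t ^ 3 = 1 := by simpa using congrArg Units.val h
        exact hω.ne_one (by norm_num) h'
      · ext
        have := hω.pow_eq_one
        rw [← pow_mul] at this
        simpa using this
    have := orderOf_dvd_natCard (Units.mk0 t ht)
    rwa [h9] at this
  · intro h
    obtain ⟨g, hg⟩ := IsCyclic.exists_generator (α := κˣ)
    obtain ⟨j, hj⟩ := (Subgroup.mem_zpowers_iff.mp (hg (Units.mk0 ω hω0)))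
    have hg9 : (9 : ℤ) ∣ orderOf g := by
      rw [orderOf_eq_card_of_forall_mem_zpowers hg]
      exact_mod_cast h
    have h1 : g ^ (j * 3) = 1 := by
      rw [zpow_mul, hj, show (3 : ℤ) = (3 : ℕ) from rfl, zpow_natCast]
      ext
      simpa using hω.pow_eq_one
    have h2 : (9 : ℤ) ∣ j * 3 := hg9.trans (orderOf_dvd_iff_zpow_eq_one.mpr h1)
    obtain ⟨m, rfl⟩ : (3 : ℤ) ∣ j := by omega
    refine ⟨((g ^ m : κˣ) : κ), ?_⟩
    have : (g ^ m) ^ 3 = Units.mk0 ω hω0 := by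
      rw [← hj, mul_comm, zpow_mul]; norm_cast
    simpa using congrArg Units.val this

lemma zetaE_isPrimitiveRoot : IsPrimitiveRoot zetaE 3 :=
  IsPrimitiveRoot.of_map_of_injective (f := algebraMap k0c ℂ) zeta3_isPrimitiveRoot
    (algebraMap k0c ℂ).injective

lemma zetaO_isPrimitiveRoot : IsPrimitiveRoot zetaO 3 :=
  IsPrimitiveRoot.of_map_of_injective (f := algebraMap (𝓞 k0c) k0c) zetaE_isPrimitiveRoot
    RingOfIntegers.coe_injective

instance : IsCyclotomicExtension {3} ℚ k0c := by
  change IsCyclotomicExtension {3} ℚ ℚ⟮zeta3⟯.toSubalgebra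
  rw [IntermediateField.adjoin_simple_toSubalgebra_of_isAlgebraic isIntegral_zeta3.isAlgebraic]
  exact zeta3_isPrimitiveRoot.adjoin_isCyclotomicExtension ℚ

instance : IsPrincipalIdealRing (𝓞 k0c) := IsCyclotomicExtension.Rat.three_pid k0c

lemma zetaE_sq_add : zetaE ^ 2 + zetaE + 1 = 0 := by
  simpa using zetaE_isPrimitiveRoot.isRoot_cyclotomic (by decide)

lemma zetaO_sq_add : zetaO ^ 2 + zetaO + 1 = 0 :=
  RingOfIntegers.ext zetaE_sq_add

lemma zetaO_pow_three : zetaO ^ 3 = 1 := zetaO_isPrimitiveRoot.pow_eq_one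

lemma lamO_pow_three : lamO ^ 3 = -3 * zetaO * lamO := by
  rw [lamO]
  linear_combination (1 - zetaO) * zetaO_sq_add

lemma lamO_dvd_three : lamO ∣ 3 :=
  ⟨1 - zetaO ^ 2, by rw [lamO]; linear_combination -(zetaO - 2) * zetaO_sq_add⟩

lemma exists_basis_pow_zetaO :
    ∃ b : Module.Basis (Fin 2) ℤ (𝓞 k0c), ∀ i, b i = zetaO ^ (i : ℕ) := by
  have hdim : zetaE_isPrimitiveRoot.integralPowerBasis.dim = 2 := by
    rw [zetaE_isPrimitiveRoot.integralPowerBasis_dim]; rfl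
  refine ⟨zetaE_isPrimitiveRoot.integralPowerBasis.basis.reindex (finCongr hdim), fun i => ?_⟩
  simp
  rfl

lemma exists_eq_add_mul_zetaO (x : 𝓞 k0c) : ∃ m n : ℤ, x = m + n * zetaO := by
  obtain ⟨b, hb⟩ := exists_basis_pow_zetaO
  refine ⟨b.repr x 0, b.repr x 1, ?_⟩
  conv_lhs => rw [← b.sum_repr x]
  simp [Fin.sum_univ_two, hb]

lemma norm_add_mul_zetaO (m n : ℤ) :
    Algebra.norm ℤ ((m : 𝓞 k0c) + n * zetaO) = m ^ 2 - m * n + n ^ 2 := by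
  obtain ⟨b, hb⟩ := exists_basis_pow_zetaO
  have hM : Algebra.leftMulMatrix b ((m : 𝓞 k0c) + n * zetaO) = !![m, -n; n, m - n] := by
    ext i j
    rw [Algebra.leftMulMatrix_eq_repr_mul]
    have key : ((m : 𝓞 k0c) + n * zetaO) * b j =
        ∑ l, (!![m, -n; n, m - n] : Matrix (Fin 2) (Fin 2) ℤ) l j • b l := by
      simp only [hb, Fin.sum_univ_two, zsmul_eq_mul]
      fin_cases j
      · simp
      · simp
        linear_combination (n : 𝓞 k0c) * zetaO_sq_add
    rw [key, map_sum]
    simp only [map_zsmul, Module.Basis.repr_self]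
    fin_cases i <;> simp
  rw [Algebra.norm_eq_matrix_det b, hM, Matrix.det_fin_two]
  simp
  ring

lemma add_mul_zetaO_inj {m n u v : ℤ} (h : (m : 𝓞 k0c) + n * zetaO = u + v * zetaO) :
    m = u ∧ n = v := by
  obtain ⟨b, hb⟩ := exists_basis_pow_zetaO
  have hrep : ∑ i, (![m - u, n - v] : Fin 2 → ℤ) i • b i = 0 := by
    simp [Fin.sum_univ_two, hb]
    linear_combination h
  have := Fintype.linearIndependent_iff.mp b.linearIndependent _ hrep
  have h0 := this 0
  have h1 := this 1
  simp at h0 h1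
  omega

lemma lamO_dvd_add_mul_zetaO_iff (m n : ℤ) :
    lamO ∣ (m : 𝓞 k0c) + n * zetaO ↔ (3 : ℤ) ∣ m + n := by
  constructor
  · rintro ⟨c, hc⟩
    obtain ⟨u, v, rfl⟩ := exists_eq_add_mul_zetaO c
    have h : (m : 𝓞 k0c) + n * zetaO = (u + v : ℤ) + (2 * v - u : ℤ) * zetaO := by
      rw [hc, lamO]
      push_cast
      linear_combination -(v : 𝓞 k0c) * zetaO_sq_add
    obtain ⟨rfl, rfl⟩ := add_mul_zetaO_inj h
    exact ⟨v, by ring⟩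
  · rintro ⟨c, hc⟩
    have h : (m : 𝓞 k0c) + n * zetaO = 3 * c - n * lamO := by
      have : (m : 𝓞 k0c) + n = 3 * c := by exact_mod_cast hc
      rw [lamO]
      linear_combination this
    rw [h]
    exact dvd_sub (lamO_dvd_three.mul_right _) (dvd_mul_left _ _)

lemma lamO_pow_three_dvd_three_mul_iff (c : 𝓞 k0c) : lamO ^ 3 ∣ 3 * c ↔ lamO ∣ c := by
  rw [lamO_pow_three, show -3 * zetaO * lamO = 3 * (lamO * -zetaO) by ring,
    mul_dvd_mul_iff_left (by norm_num),
    (zetaO_isPrimitiveRoot.isUnit (by norm_num)).neg.mul_right_dvd]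

lemma natCard_quotient_span (x : 𝓞 k0c) :
    Nat.card (𝓞 k0c ⧸ Ideal.span {x}) = (Algebra.norm ℤ x).natAbs := by
  rw [← Ideal.absNorm_span_singleton]
  rfl

/-- For `π ≡ 1 (mod 3)`, one has `π ≡ 1 (mod λ³)` iff the norm of `π` is `1` modulo `9`. -/
lemma nine_dvd_card_sub_one_iff {π : 𝓞 k0c} (h3 : 3 ∣ π - 1) :
    9 ∣ Nat.card (𝓞 k0c ⧸ Ideal.span {π}) - 1 ↔ lamO ^ 3 ∣ π - 1 := by
  obtain ⟨c, hc⟩ := h3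
  rw [hc, lamO_pow_three_dvd_three_mul_iff]
  obtain ⟨m, n, rfl⟩ := exists_eq_add_mul_zetaO c
  have hπ : π = (1 + 3 * m : ℤ) + (3 * n : ℤ) * zetaO := by
    push_cast
    linear_combination hc
  rw [lamO_dvd_add_mul_zetaO_iff, natCard_quotient_span, hπ, norm_add_mul_zetaO]
  have hN : (1 + 3 * m) ^ 2 - (1 + 3 * m) * (3 * n) + (3 * n) ^ 2 =
      1 + (6 * m - 3 * n) + 9 * (m ^ 2 - m * n + n ^ 2) := by ring
  have hpos : 0 ≤ (1 + 3 * m) ^ 2 - (1 + 3 * m) * (3 * n) + (3 * n) ^ 2 := by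
    nlinarith [sq_nonneg (2 * (1 + 3 * m) - 3 * n), sq_nonneg n]
  rw [hN] at hpos ⊢
  generalize m ^ 2 - m * n + n ^ 2 = t at *
  omega

lemma not_dvd_three_of_dvd_sub_one {R : Type*} [CommRing R] {π : R} (hπ : Prime π)
    (h3 : 3 ∣ π - 1) : ¬ π ∣ 3 := fun h =>
  hπ.not_isUnit (isUnit_of_dvd_one ((dvd_sub_right (dvd_refl π)).mp (h.trans h3)))

/-- For a prime `π ≡ 1 (mod 3)`, `ζ₃` is a cube modulo `π` iff `π ≡ 1 (mod λ³)`. -/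
lemma exists_dvd_zetaO_mul_cube_sub_cube_iff {π : 𝓞 k0c} (hπ : Prime π) (h3 : 3 ∣ π - 1) :
    (∃ s t, ¬ π ∣ s ∧ π ∣ zetaO * s ^ 3 - t ^ 3) ↔ lamO ^ 3 ∣ π - 1 := by
  have hne : Ideal.span {π} ≠ ⊥ := by simpa using hπ.ne_zero
  have : (Ideal.span {π}).IsMaximal :=
    ((Ideal.span_singleton_prime hπ.ne_zero).mpr hπ).isMaximal hne
  let _ : Field (𝓞 k0c ⧸ Ideal.span {π}) := Ideal.Quotient.field _
  have : Finite (𝓞 k0c ⧸ Ideal.span {π}) := Ideal.finiteQuotientOfFreeOfNeBot _ hne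
  have hmk (x : 𝓞 k0c) : Ideal.Quotient.mk (Ideal.span {π}) x = 0 ↔ π ∣ x := by
    rw [Ideal.Quotient.eq_zero_iff_mem, Ideal.mem_span_singleton]
  have hl : ¬ π ∣ lamO := fun h => not_dvd_three_of_dvd_sub_one hπ h3 (h.trans lamO_dvd_three)
  have hω : IsPrimitiveRoot (Ideal.Quotient.mk (Ideal.span {π}) zetaO) 3 := by
    rw [IsPrimitiveRoot.iff_orderOf]
    refine orderOf_eq_prime (by rw [← map_pow, zetaO_pow_three, map_one]) fun h => hl ?_
    rw [← hmk, lamO, map_sub, h, map_one, sub_self]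
  rw [← nine_dvd_card_sub_one_iff h3, ← exists_cube_eq_iff_nine_dvd hω]
  constructor
  · rintro ⟨s, t, hs, hst⟩
    rw [← hmk] at hs hst
    rw [map_sub, map_mul, map_pow, map_pow, sub_eq_zero] at hst
    exact ⟨_, (div_pow _ _ 3).trans ((div_eq_iff (pow_ne_zero 3 hs)).mpr hst.symm)⟩
  · rintro ⟨t, ht⟩
    obtain ⟨t, rfl⟩ := Ideal.Quotient.mk_surjective t
    refine ⟨1, t, fun h => hπ.not_isUnit (isUnit_of_dvd_one h), ?_⟩
    rw [← hmk]
    simp [ht]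

lemma isCyclotomicExtension_nine_rat :
    IsCyclotomicExtension {9} ℚ (CyclotomicField 9 k0c) := by
  have h := IsCyclotomicExtension.trans {3} {9} ℚ k0c (CyclotomicField 9 k0c)
    (algebraMap k0c _).injective
  rw [Set.union_comm] at h
  exact (IsCyclotomicExtension.iff_union_of_dvd (S := {9}) (n := 3) ℚ (CyclotomicField 9 k0c)
    ⟨9, rfl, by norm_num, by norm_num⟩).mpr h

/-- The ring of integers of the ninth cyclotomic field is a principal ideal domain. -/
theorem isPrincipalIdealRing_of_isCyclotomicExtension_nine (K : Type*) [Field K] [NumberField K]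
    [hK : IsCyclotomicExtension {9} ℚ K] : IsPrincipalIdealRing (𝓞 K) := by
  have : IsGalois ℚ K := IsCyclotomicExtension.isGalois {9} ℚ K
  have hK' : IsCyclotomicExtension {3 ^ (1 + 1)} ℚ K := hK
  have hfin : Module.finrank ℚ K = 6 := by
    rw [IsCyclotomicExtension.Rat.finrank 9 K]; decide
  have hcomplex : NumberField.InfinitePlace.nrComplexPlaces K = 3 := by
    rw [IsCyclotomicExtension.Rat.nrComplexPlaces_eq_totient_div_two 9 K]; decide
  have hdisc : NumberField.discr K = -19683 := by
    rw [IsCyclotomicExtension.Rat.discr_prime_pow_succ 3 1 K]; norm_num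
  have hM : ⌊(4 / Real.pi) ^ NumberField.InfinitePlace.nrComplexPlaces K *
      ((Module.finrank ℚ K).factorial / (Module.finrank ℚ K : ℝ) ^ Module.finrank ℚ K *
        √|NumberField.discr K|)⌋₊ ≤ 4 := by
    rw [hfin, hcomplex, hdisc]
    have hpi : 4 / Real.pi ≤ 4 / 3.14 := by
      gcongr
      exact Real.pi_gt_d2.le
    have hsqrt : √|((-19683 : ℤ) : ℝ)| ≤ 141 := by
      rw [Real.sqrt_le_left (by norm_num)]
      norm_num
    have hfact : (Nat.factorial 6 : ℝ) = 720 := by norm_num [Nat.factorial]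
    rw [hfact]
    refine Nat.le_of_lt_succ ((Nat.floor_lt (by positivity)).mpr ?_)
    calc (4 / Real.pi) ^ 3 * (720 / ((6 : ℕ) : ℝ) ^ 6 * √|((-19683 : ℤ) : ℝ)|)
        ≤ (4 / 3.14) ^ 3 * (720 / ((6 : ℕ) : ℝ) ^ 6 * 141) := by gcongr
      _ < _ := by norm_num
  apply
    RingOfIntegers.isPrincipalIdealRing_of_isPrincipal_of_lt_or_isPrincipal_of_mem_primesOver_of_mem_Icc
  intro p hp hprime
  have hp4 : p ≤ 4 := (Finset.mem_Icc.mp hp).2.trans hM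
  have hp2 := hprime.two_le
  have hfact : Fact p.Prime := ⟨hprime⟩
  interval_cases p
  · obtain ⟨P, hP, hP'⟩ := (Ideal.span {((2 : ℕ) : ℤ)}).nonempty_primesOver (S := 𝓞 K)
    refine ⟨P, ⟨hP, hP'⟩, Or.inl ?_⟩
    rw [IsCyclotomicExtension.Rat.inertiaDeg_eq_of_not_dvd (m := 9) 2 K P (by norm_num)]
    have h6 : orderOf ((2 : ℕ) : ZMod 9) = 6 := by
      rw [orderOf_eq_iff (by norm_num)]
      decide
    rw [h6]
    exact hM.trans_lt (by norm_num)
  · have hζ : IsPrimitiveRoot (IsCyclotomicExtension.zeta 9 ℚ K) (3 ^ (1 + 1)) :=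
      IsCyclotomicExtension.zeta_spec 9 ℚ K
    exact ⟨Ideal.span {hζ.toInteger - 1},
      ⟨IsCyclotomicExtension.Rat.isPrime_span_zeta_sub_one 3 1 hζ,
        IsCyclotomicExtension.Rat.liesOver_span_zeta_sub_one 3 1 hζ⟩, Or.inr ⟨_, rfl⟩⟩
  · norm_num at hprime

lemma finrank_cyclotomicField_nine : Module.finrank k0c (CyclotomicField 9 k0c) = 3 := by
  have := isCyclotomicExtension_nine_rat
  have h := Module.finrank_mul_finrank ℚ k0c (CyclotomicField 9 k0c)
  rw [IsCyclotomicExtension.Rat.finrank 9 (CyclotomicField 9 k0c),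
    IsCyclotomicExtension.Rat.finrank 3 k0c, show Nat.totient 9 = 6 from by decide,
    show Nat.totient 3 = 2 from by decide] at h
  omega

lemma exists_cube_eq_zetaE :
    ∃ β : CyclotomicField 9 k0c, β ^ 3 = algebraMap k0c (CyclotomicField 9 k0c) zetaE := by
  have hβ := IsCyclotomicExtension.zeta_spec 9 k0c (CyclotomicField 9 k0c)
  have h3 : IsPrimitiveRoot (IsCyclotomicExtension.zeta 9 k0c (CyclotomicField 9 k0c) ^ 3) 3 :=
    hβ.pow (by norm_num) (by norm_num)
  have h3' := zetaE_isPrimitiveRoot.map_of_injective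
    (algebraMap k0c (CyclotomicField 9 k0c)).injective
  obtain ⟨i, -, hi⟩ := h3.eq_pow_of_pow_eq_one h3'.pow_eq_one
  refine ⟨IsCyclotomicExtension.zeta 9 k0c (CyclotomicField 9 k0c) ^ i, ?_⟩
  rw [← hi]
  ring

lemma zetaE_ne_cube (y : k0c) : y ^ 3 ≠ zetaE := by
  intro h
  have h9 : IsPrimitiveRoot y (3 ^ (1 + 1)) := by
    rw [IsPrimitiveRoot.iff_orderOf]
    refine orderOf_eq_prime_pow ?_ ?_
    · rw [pow_one, h]
      exact zetaE_isPrimitiveRoot.ne_one (by norm_num)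
    · rw [pow_succ, pow_mul, pow_one, h]
      exact zetaE_isPrimitiveRoot.pow_eq_one
  have h6 := IsPrimitiveRoot.lcm_totient_le_finrank (K := ℚ) h9 zetaE_isPrimitiveRoot
    (Polynomial.cyclotomic.irreducible_rat (by decide))
  rw [IsCyclotomicExtension.Rat.finrank 3 k0c] at h6
  revert h6
  decide

/-- The elements of `ℚ(ζ₃)` that are norms from `ℚ(ζ₉)`. -/
def ninthNorms : Submonoid k0c := MonoidHom.mrange (Algebra.norm k0c (S := CyclotomicField 9 k0c))

lemma inv_mem_ninthNorms {x : k0c} (hx : x ∈ ninthNorms) : x⁻¹ ∈ ninthNorms := by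
  obtain ⟨y, rfl⟩ := hx
  refine ⟨y⁻¹, ?_⟩
  rcases eq_or_ne y 0 with rfl | hy
  · simp [Algebra.norm_zero]
  · refine eq_inv_of_mul_eq_one_left ?_
    rw [← map_mul, inv_mul_cancel₀ hy, map_one]

lemma cube_mem_ninthNorms (x : k0c) : x ^ 3 ∈ ninthNorms :=
  ⟨algebraMap _ _ x, by rw [Algebra.norm_algebraMap, finrank_cyclotomicField_nine]⟩

lemma mem_ninthNorms_iff (x : k0c) : x ∈ ninthNorms ↔ ∃ p q r : k0c,
    x = p ^ 3 + zetaE * q ^ 3 + zetaE ^ 2 * r ^ 3 - 3 * zetaE * p * q * r := by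
  obtain ⟨β, hβ⟩ := exists_cube_eq_zetaE
  have hN := norm_add_mul_add_mul_sq hβ zetaE_ne_cube finrank_cyclotomicField_nine
  constructor
  · rintro ⟨y, rfl⟩
    obtain ⟨p, q, r, rfl⟩ :=
      exists_eq_add_mul_add_mul_sq hβ zetaE_ne_cube finrank_cyclotomicField_nine y
    exact ⟨p, q, r, hN p q r⟩
  · rintro ⟨p, q, r, rfl⟩
    exact ⟨_, hN p q r⟩

lemma zetaE_mem_ninthNorms : zetaE ∈ ninthNorms := (mem_ninthNorms_iff _).mpr ⟨0, 1, 0, by ring⟩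

lemma lamO_mem_ninthNorms : (lamO : k0c) ∈ ninthNorms :=
  (mem_ninthNorms_iff _).mpr ⟨1, -1, 0, by
    change 1 - zetaE = _
    ring⟩

lemma unit_mem_ninthNorms (u : (𝓞 k0c)ˣ) : ((u : 𝓞 k0c) : k0c) ∈ ninthNorms := by
  have hneg {x : k0c} (hx : x ∈ ninthNorms) : -x ∈ ninthNorms := by
    have h := mul_mem (cube_mem_ninthNorms (-1)) hx
    rwa [show (-1 : k0c) ^ 3 * x = -x by ring] at h
  have h1 : (1 : k0c) ∈ ninthNorms := one_mem _
  have hz := zetaE_mem_ninthNorms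
  have hz2 := pow_mem zetaE_mem_ninthNorms 2
  have hu := IsCyclotomicExtension.Rat.Three.Units.mem zetaE_isPrimitiveRoot u
  simp only [List.mem_cons, List.not_mem_nil, or_false] at hu
  rcases hu with rfl | rfl | rfl | rfl | rfl | rfl
  · exact h1
  · simpa using hneg h1
  · exact hz
  · exact hneg hz
  · exact hz2
  · exact hneg hz2

/-- A prime `π ≡ 1 (mod λ³)` does not stay prime in `ℚ(ζ₉)`. -/
lemma not_prime_algebraMap_ninth {π : 𝓞 k0c} (hπ : Prime π) (h3 : 3 ∣ π - 1)
    (h : lamO ^ 3 ∣ π - 1) : ¬ Prime (algebraMap (𝓞 k0c) (𝓞 (CyclotomicField 9 k0c)) π) := by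
  intro hP
  obtain ⟨s, t, hs, hst⟩ := (exists_dvd_zetaO_mul_cube_sub_cube_iff hπ h3).mpr h
  obtain ⟨β, hβ⟩ := exists_cube_eq_zetaE
  have hβint : IsIntegral ℤ β := by
    refine IsIntegral.of_pow (n := 3) (by norm_num) ?_
    rw [hβ]
    exact isIntegral_zetaE.algebraMap
  set f := algebraMap (𝓞 k0c) (𝓞 (CyclotomicField 9 k0c)) with hf
  set B : 𝓞 (CyclotomicField 9 k0c) := ⟨β, hβint⟩ with hB
  have hB3 : B ^ 3 = f zetaO := RingOfIntegers.ext hβ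
  have hω : f zetaO ^ 2 + f zetaO + 1 = 0 := by
    rw [← map_pow, ← map_add, ← map_one f, ← map_add, zetaO_sq_add, map_zero]
  have hfac : f (zetaO * s ^ 3 - t ^ 3) =
      (f (zetaO ^ 0 * s) * B - f t) * ((f (zetaO ^ 1 * s) * B - f t) *
        (f (zetaO ^ 2 * s) * B - f t)) := by
    simp only [map_sub, map_mul, map_pow]
    linear_combination -f s ^ 3 * hB3 + (-f s ^ 3 * B ^ 3 * (f zetaO - 1) +
      f t * f s ^ 2 * B ^ 2 * f zetaO - f t ^ 2 * f s * B) * hω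
  have hdvd : ∃ i : ℕ, f π ∣ f (zetaO ^ i * s) * B - f t := by
    have := map_dvd f hst
    rw [hfac] at this
    rcases hP.dvd_or_dvd this with h | h
    · exact ⟨_, h⟩
    · rcases hP.dvd_or_dvd h with h | h <;> exact ⟨_, h⟩
  obtain ⟨i, c, hc⟩ := hdvd
  have hπ0 : (π : k0c) ≠ 0 := RingOfIntegers.coe_ne_zero_iff.mpr hπ.ne_zero
  have htr := trace_add_mul_add_mul_sq hβ zetaE_ne_cube finrank_cyclotomicField_nine
    (((zetaO ^ (i + 1) * s : 𝓞 k0c) : k0c) / π) 0 (-(t : k0c) / π)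
  have hcB : algebraMap k0c (CyclotomicField 9 k0c) (((zetaO ^ (i + 1) * s : 𝓞 k0c) : k0c) / π) +
      algebraMap k0c _ 0 * β + algebraMap k0c _ (-(t : k0c) / π) * β ^ 2 = ((c * B ^ 2 : 𝓞 _) :
        CyclotomicField 9 k0c) := by
    have hc' : algebraMap k0c (CyclotomicField 9 k0c) ((zetaO ^ i * s : 𝓞 k0c) : k0c) * β -
        algebraMap k0c _ (t : k0c) = algebraMap k0c _ (π : k0c) * (c : CyclotomicField 9 k0c) :=
      congrArg (fun x : 𝓞 (CyclotomicField 9 k0c) => (x : CyclotomicField 9 k0c)) hc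
    have hπ0' : algebraMap k0c (CyclotomicField 9 k0c) (π : k0c) ≠ 0 := by simpa using hπ0
    have hmul : ((zetaO ^ (i + 1) * s : 𝓞 k0c) : k0c) = zetaE * ((zetaO ^ i * s : 𝓞 k0c) : k0c) :=
      congrArg (fun x : 𝓞 k0c => (x : k0c)) (show _ = zetaO * (zetaO ^ i * s) by ring)
    have hcB' : ((c * B ^ 2 : 𝓞 _) : CyclotomicField 9 k0c) = c * β ^ 2 := rfl
    rw [hcB', hmul, map_div₀, map_div₀, map_mul, map_neg, map_zero, ← hβ]
    field_simp
    linear_combination β ^ 2 * hc'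
  rw [hcB] at htr
  have hint : IsIntegral ℤ (Algebra.trace k0c (CyclotomicField 9 k0c) (c * B ^ 2 : 𝓞 _)) :=
    Algebra.isIntegral_trace (RingOfIntegers.isIntegral_coe _)
  obtain ⟨d, hd⟩ : ∃ d : 𝓞 k0c, (d : k0c) =
      Algebra.trace k0c (CyclotomicField 9 k0c) (c * B ^ 2 : 𝓞 _) := ⟨⟨_, hint⟩, rfl⟩
  have hdvd3 : π ∣ 3 * (zetaO ^ (i + 1) * s) := by
    refine ⟨d, RingOfIntegers.ext ?_⟩
    change (3 : k0c) * ((zetaO ^ (i + 1) * s : 𝓞 k0c) : k0c) = (π : k0c) * (d : k0c)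
    rw [hd, htr]
    field_simp
  rcases hπ.dvd_or_dvd hdvd3 with h | h
  · exact not_dvd_three_of_dvd_sub_one hπ h3 h
  · rcases hπ.dvd_or_dvd h with h | h
    · exact hπ.not_isUnit (isUnit_of_dvd_unit h
        ((zetaO_isPrimitiveRoot.isUnit (by norm_num)).pow _))
    · exact hs h

lemma prime_mem_ninthNorms {π : 𝓞 k0c} (hπ : Prime π) (h3 : 3 ∣ π - 1) (h : lamO ^ 3 ∣ π - 1) :
    (π : k0c) ∈ ninthNorms := by
  have := isCyclotomicExtension_nine_rat
  have := isPrincipalIdealRing_of_isCyclotomicExtension_nine (CyclotomicField 9 k0c)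
  have hnorm : RingOfIntegers.norm k0c (algebraMap (𝓞 k0c) (𝓞 (CyclotomicField 9 k0c)) π) =
      π ^ 3 := by
    rw [RingOfIntegers.norm_algebraMap, finrank_cyclotomicField_nine]
  have hunit : ¬ IsUnit (algebraMap (𝓞 k0c) (𝓞 (CyclotomicField 9 k0c)) π) := by
    rw [← RingOfIntegers.isUnit_norm k0c, hnorm]
    exact fun hu => hπ.not_isUnit ((isUnit_pow_iff (by norm_num)).mp hu)
  obtain ⟨a, b, ha, hb, hab⟩ : ∃ a b, ¬ IsUnit a ∧ ¬ IsUnit b ∧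
      algebraMap (𝓞 k0c) (𝓞 (CyclotomicField 9 k0c)) π = a * b := by
    have hirr := mt irreducible_iff_prime.mp (not_prime_algebraMap_ninth hπ h3 h)
    rw [irreducible_iff] at hirr
    push Not at hirr
    obtain ⟨a, b, hab, ha, hb⟩ := hirr hunit
    exact ⟨a, b, ha, hb, hab⟩
  rw [← RingOfIntegers.isUnit_norm k0c] at ha hb
  rw [hab, map_mul] at hnorm
  obtain ⟨i, hi, u, hu⟩ := (dvd_prime_pow hπ 3).mp (Dvd.intro _ hnorm)
  have hmem : (π : k0c) ^ i ∈ ninthNorms := by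
    rw [← map_pow, ← hu, map_mul]
    exact mul_mem ⟨_, rfl⟩ (unit_mem_ninthNorms u)
  interval_cases i
  · exact absurd (IsUnit.of_mul_eq_one _ (hu.trans (pow_zero π))) ha
  · simpa using hmem
  · have hπ0 : (π : k0c) ≠ 0 := RingOfIntegers.coe_ne_zero_iff.mpr hπ.ne_zero
    have := mul_mem (cube_mem_ninthNorms π) (inv_mem_ninthNorms hmem)
    rwa [show (π : k0c) ^ 3 * ((π : k0c) ^ 2)⁻¹ = π by field_simp] at this
  · have hN0 : RingOfIntegers.norm k0c a ≠ 0 := by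
      rintro h0
      rw [h0, zero_mul] at hnorm
      exact pow_ne_zero 3 hπ.ne_zero hnorm.symm
    rw [← hnorm] at hu
    exact absurd (mul_left_cancel₀ hN0 hu ▸ u.isUnit) hb

lemma lamO_pow_three_dvd_sub_one_of_norm_form {π u : 𝓞 k0c} (hπ : Prime π) (h3 : 3 ∣ π - 1)
    (hu : ¬ π ∣ u) {x y w : k0c}
    (h : zetaE = x ^ 3 + π * u * y ^ 3 + (π * u) ^ 2 * w ^ 3 - 3 * (π * u) * x * y * w) :
    lamO ^ 3 ∣ π - 1 := by
  rw [← exists_dvd_zetaO_mul_cube_sub_cube_iff hπ h3]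
  obtain ⟨x, a, ha, rfl⟩ := IsFractionRing.div_surjective (A := 𝓞 k0c) x
  obtain ⟨y, b, hb, rfl⟩ := IsFractionRing.div_surjective (A := 𝓞 k0c) y
  obtain ⟨w, c, hc, rfl⟩ := IsFractionRing.div_surjective (A := 𝓞 k0c) w
  have ha := nonZeroDivisors.ne_zero ha
  have hb := nonZeroDivisors.ne_zero hb
  have hc := nonZeroDivisors.ne_zero hc
  have ha' : (a : k0c) ≠ 0 := RingOfIntegers.coe_ne_zero_iff.mpr ha
  have hb' : (b : k0c) ≠ 0 := RingOfIntegers.coe_ne_zero_iff.mpr hb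
  have hc' : (c : k0c) ≠ 0 := RingOfIntegers.coe_ne_zero_iff.mpr hc
  refine exists_dvd_mul_cube_sub_cube (d := a * b * c) (x := x * b * c) (y := y * a * c)
    (w := w * a * b) hπ hu (mul_ne_zero (mul_ne_zero ha hb) hc) ?_
  apply RingOfIntegers.coe_injective
  have hz : algebraMap (𝓞 k0c) k0c zetaO = zetaE := rfl
  simp only [map_mul, map_add, map_sub, map_pow, map_ofNat, hz]
  rw [h]
  field_simp

lemma lamO_pow_three_dvd_sub_one_of_norm_form_pow {π u : 𝓞 k0c} {n : ℕ} (hn : 1 ≤ n ∧ n ≤ 2)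
    (hπ : Prime π) (h3 : 3 ∣ π - 1) (hu : ¬ π ∣ u) {a x y w : k0c} (ha : a = π ^ n * u)
    (h : zetaE = x ^ 3 + a * y ^ 3 + a ^ 2 * w ^ 3 - 3 * a * x * y * w) :
    lamO ^ 3 ∣ π - 1 := by
  subst ha
  obtain ⟨hn1, hn2⟩ := hn
  interval_cases n
  · exact lamO_pow_three_dvd_sub_one_of_norm_form hπ h3 hu (by simpa only [pow_one] using h)
  · have hu0 : (u : k0c) ≠ 0 := RingOfIntegers.coe_ne_zero_iff.mpr
      (by rintro rfl; exact hu (dvd_zero π))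
    refine lamO_pow_three_dvd_sub_one_of_norm_form (u := u ^ 2) (x := x) (y := π * w)
      (w := y / u) hπ h3 (fun h => hu (hπ.dvd_of_dvd_pow h)) ?_
    rw [h, show ((u ^ 2 : 𝓞 k0c) : k0c) = (u : k0c) ^ 2 from map_pow (algebraMap _ _) u 2]
    field_simp
    ring

/-- The classes modulo `λ³` of the elements congruent to `1` modulo `3` are `1`, `4` and `7`. -/
lemma not_lamO_pow_three_dvd_sub_one_iff {π : 𝓞 k0c} (h3 : 3 ∣ π - 1) :
    ¬ lamO ^ 3 ∣ π - 1 ↔ lamO ^ 3 ∣ π - 4 ∨ lamO ^ 3 ∣ π - 7 := by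
  obtain ⟨c, hc⟩ := h3
  obtain ⟨m, n, rfl⟩ := exists_eq_add_mul_zetaO c
  have h4 : π - 4 = 3 * (((m - 1 : ℤ) : 𝓞 k0c) + n * zetaO) := by
    push_cast
    linear_combination hc
  have h7 : π - 7 = 3 * (((m - 2 : ℤ) : 𝓞 k0c) + n * zetaO) := by
    push_cast
    linear_combination hc
  rw [hc, h4, h7]
  simp only [lamO_pow_three_dvd_three_mul_iff, lamO_dvd_add_mul_zetaO_iff]
  omega

lemma finrank_adjoin_of_cube_eq {k L : Type*} [Field k] [Field L] [Algebra k L] {a : k} {z : L}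
    (hz : z ^ 3 = algebraMap k L a) (ha : ∀ y : k, y ^ 3 ≠ a) :
    Module.finrank k k⟮z⟯ = 3 := by
  have hroot : Polynomial.aeval z (Polynomial.X ^ 3 - Polynomial.C a) = 0 := by simp [hz]
  have hmonic : (Polynomial.X ^ 3 - Polynomial.C a).Monic :=
    Polynomial.monic_X_pow_sub_C a (by norm_num)
  rw [IntermediateField.adjoin.finrank ⟨_, hmonic, hroot⟩, ← minpoly.eq_of_irreducible_of_monic
    (X_pow_sub_C_irreducible_of_prime Nat.prime_three ha) hroot hmonic,
    Polynomial.natDegree_X_pow_sub_C]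

/-- **Lemma 3.3** (Gerth): for a cubic Kummer extension `K = k₀(∛θ)` of `k₀ = ℚ(ζ₃)` with
cube-free radicand `θ = λ^{e_λ}·ζ₃^{e_ζ}·π₁^{e₁}⋯π_g^{e_g}` (the `π_i` pairwise
non-associate primary prime elements of `ℤ[ζ₃]`), `ζ₃` is a relative norm from `K^×` iff
all `π_i ≡ 1 (mod λ³)`; equivalently, `ζ₃` is not a relative norm iff some
`π_i ≡ 4, 7 (mod λ³)`. -/
theorem zeta_norm_criterion_kummer
    (g : ℕ) (π : Fin g → 𝓞 k0c) (e : Fin g → ℕ) (eLam eZeta : ℕ)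
    (heLam : eLam ≤ 2) (heZeta : eZeta ≤ 2)
    (he : ∀ i, 1 ≤ e i ∧ e i ≤ 2)
    (hπ : ∀ i, Prime (π i))
    (hnonassoc : ∀ i j, i ≠ j → ¬ Associated (π i) (π j))
    (hprimary : ∀ i, (3 : 𝓞 k0c) ∣ (π i - 1))
    (θ : 𝓞 k0c) (hθ : θ = lamO ^ eLam * zetaO ^ eZeta * ∏ i, π i ^ e i)
    (hnotcube : ∀ y : ↥k0c, y ^ 3 ≠ (θ : ↥k0c))
    (z : ℂ) (hz : z ^ 3 = ((θ : ↥k0c) : ℂ)) :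
    ((∃ Z : ↥(IntermediateField.adjoin ↥k0c {z}), Z ≠ 0 ∧
        Algebra.norm ↥k0c Z = (zetaO : ↥k0c)) ↔
      ∀ i, lamO ^ 3 ∣ (π i - 1)) ∧
    ((¬ ∃ Z : ↥(IntermediateField.adjoin ↥k0c {z}), Z ≠ 0 ∧
        Algebra.norm ↥k0c Z = (zetaO : ↥k0c)) ↔
      ∃ i, lamO ^ 3 ∣ (π i - 4) ∨ lamO ^ 3 ∣ (π i - 7)) := by
  have hK := finrank_adjoin_of_cube_eq (k := k0c) (L := ℂ) hz hnotcube
  have hα : IntermediateField.AdjoinSimple.gen k0c z ^ 3 =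
      algebraMap k0c (IntermediateField.adjoin k0c {z}) (θ : k0c) :=
    Subtype.ext hz
  have key : (∃ Z : ↥(IntermediateField.adjoin ↥k0c {z}), Z ≠ 0 ∧
      Algebra.norm ↥k0c Z = (zetaO : ↥k0c)) ↔ ∀ i, lamO ^ 3 ∣ (π i - 1) := by
    constructor
    · rintro ⟨Z, -, hZ⟩ i
      obtain ⟨x, y, w, rfl⟩ := exists_eq_add_mul_add_mul_sq hα hnotcube hK Z
      rw [norm_add_mul_add_mul_sq hα hnotcube hK] at hZ
      refine lamO_pow_three_dvd_sub_one_of_norm_form_pow (he i) (hπ i) (hprimary i)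
        (u := lamO ^ eLam * zetaO ^ eZeta * ∏ j ∈ Finset.univ.erase i, π j ^ e j) ?_ ?_ hZ.symm
      · intro h
        rcases (hπ i).dvd_or_dvd h with h | h
        · rcases (hπ i).dvd_or_dvd h with h | h
          · exact not_dvd_three_of_dvd_sub_one (hπ i) (hprimary i)
              (((hπ i).dvd_of_dvd_pow h).trans lamO_dvd_three)
          · exact (hπ i).not_isUnit (isUnit_of_dvd_unit h
              ((zetaO_isPrimitiveRoot.isUnit (by norm_num)).pow _))
        · obtain ⟨j, hj, h⟩ := ((hπ i).dvd_finsetProd_iff _).mp h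
          exact hnonassoc i j (Finset.ne_of_mem_erase hj).symm
            ((hπ i).associated_of_dvd (hπ j) ((hπ i).dvd_of_dvd_pow h))
      · rw [← map_pow, ← map_mul, hθ, ← Finset.mul_prod_erase _ _ (Finset.mem_univ i)]
        congr 1
        ring
    · intro h
      have hmem : (θ : k0c) ∈ ninthNorms := by
        have hcoe := congrArg (algebraMap (𝓞 k0c) k0c) hθ
        simp only [map_mul, map_prod, map_pow] at hcoe
        rw [show (θ : k0c) = _ from hcoe]
        refine mul_mem (mul_mem (pow_mem lamO_mem_ninthNorms _) (pow_mem zetaE_mem_ninthNorms _))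
          (prod_mem fun i _ => ?_)
        exact pow_mem (prime_mem_ninthNorms (hπ i) (hprimary i) (h i)) _
      obtain ⟨p, q, r, hpqr⟩ := (mem_ninthNorms_iff _).mp hmem
      exact exists_norm_eq_of_eq_norm_form zetaE_sq_add hα hnotcube hK hpqr
  refine ⟨key, ?_⟩
  rw [key, not_forall]
  exact exists_congr fun i => not_lamO_pow_three_dvd_sub_one_iff (hprimary i)

end
end

section
/- Let d > 1 be a cube-free integer and k = ℚ(∛d, ζ₃). Then ζ₃ is the relative norm N_{k/k₀}(Z) of some element Z ∈ k^× if and only if every prime divisor ℓ ≠ 3 of d satisfies ℓ ≡ ±1 (mod 9). In particular, if ζ₃ is the norm of a unit of the ring of integers of k, then every prime divisor ℓ ≠ 3 of d satisfies ℓ ≡ ±1 (mod 9). -/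
open IntermediateField NumberField
open scoped nonZeroDivisors

set_option synthInstance.maxHeartbeats 1000000
set_option maxHeartbeats 2000000

noncomputable section

instance : Fact (Nat.Prime 3) := ⟨by norm_num⟩

/-- A positive integer is cube-free if no prime cube divides it. -/
def IsCubeFree (d : ℕ) : Prop := ∀ p : ℕ, p.Prime → ¬ (p ^ 3 ∣ d)

/-- The real cube root of `d`, as a complex number. -/
def cbrt (d : ℕ) : ℂ := ((d : ℝ) ^ ((3 : ℝ)⁻¹) : ℝ)

lemma cbrt_pow_three (d : ℕ) : (cbrt d) ^ 3 = (d : ℂ) := by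
  have h : ((d : ℝ) ^ ((3 : ℝ)⁻¹)) ^ (3 : ℕ) = (d : ℝ) := by
    rw [← Real.rpow_natCast ((d : ℝ) ^ ((3 : ℝ)⁻¹)) 3, ← Real.rpow_mul (by positivity)]
    norm_num
  calc (cbrt d) ^ 3 = (((((d : ℝ) ^ ((3 : ℝ)⁻¹)) ^ (3:ℕ) : ℝ)) : ℂ) := by
        push_cast [cbrt]; ring
    _ = ((d : ℝ) : ℂ) := by rw [h]
    _ = (d : ℂ) := by norm_num

lemma isIntegral_cbrt (d : ℕ) : IsIntegral ℚ (cbrt d) := by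
  have h : IsIntegral ℤ (cbrt d) := by
    refine ⟨Polynomial.X ^ 3 - Polynomial.C (d : ℤ), ?_, ?_⟩
    · exact Polynomial.monic_X_pow_sub_C _ (by norm_num)
    · simp [Polynomial.eval₂, cbrt_pow_three d]
  exact h.tower_top

/-- `k = ℚ(∛d, ζ₃)`, the normal closure of the pure cubic field `ℚ(∛d)`,
realized as a subfield of `ℂ`. -/
def Kc (d : ℕ) : IntermediateField ℚ ℂ := ℚ⟮cbrt d, zeta3⟯

instance (d : ℕ) : NumberField (Kc d) where
  to_finiteDimensional := by
    apply IntermediateField.finiteDimensional_adjoin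
    rintro x (rfl | rfl)
    · exact isIntegral_cbrt d
    · exact isIntegral_zeta3

lemma zeta3_mem (d : ℕ) : zeta3 ∈ Kc d :=
  IntermediateField.subset_adjoin _ _ (by simp)

lemma cbrt_mem (d : ℕ) : cbrt d ∈ Kc d :=
  IntermediateField.subset_adjoin _ _ (by simp)

/-- `ζ₃` as an element of `k`. -/
def zetaK (d : ℕ) : Kc d := ⟨zeta3, zeta3_mem d⟩

/-- `∛d` as an element of `k`. -/
def cbrtK (d : ℕ) : Kc d := ⟨cbrt d, cbrt_mem d⟩

/-- `k₀ = ℚ(ζ₃)` realized as a subfield of `k`. -/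
def k0S (d : ℕ) : IntermediateField ℚ (Kc d) := ℚ⟮zetaK d⟯

/-- `L = ℚ(∛d)` realized as a subfield of `k`. -/
def LS (d : ℕ) : IntermediateField ℚ (Kc d) := ℚ⟮cbrtK d⟯

instance (d : ℕ) : NumberField ↥(k0S d) where
instance (d : ℕ) : NumberField ↥(LS d) where

/-- `ζ₃` as an element of `k₀ ⊆ k`. -/
def zetaK0 (d : ℕ) : ↥(k0S d) := ⟨zetaK d, IntermediateField.mem_adjoin_simple_self ℚ (zetaK d)⟩

/-- `∛d` as an element of `L ⊆ k`. -/
def cbrtL (d : ℕ) : ↥(LS d) := ⟨cbrtK d, IntermediateField.mem_adjoin_simple_self ℚ (cbrtK d)⟩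

/-- The norm form of `R[X] / (X ^ 3 - a)` with respect to the basis `1, X, X ^ 2`. -/
def cubicForm {R : Type*} [CommRing R] (a x y z : R) : R :=
  x ^ 3 + a * y ^ 3 + a ^ 2 * z ^ 3 - 3 * a * x * y * z

lemma cubicForm_mul {R : Type*} [CommRing R] (a x y z x' y' z' : R) :
    cubicForm a x y z * cubicForm a x' y' z' =
      cubicForm a (x * x' + a * (y * z' + z * y')) (x * y' + y * x' + a * z * z')
        (x * z' + y * y' + z * x') := by
  simp only [cubicForm]; ring

lemma trace_root {F : Type*} [Field F] {t : F} (ht0 : t ≠ 0) :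
    (t + t⁻¹) ^ 3 - 3 * (t + t⁻¹) + 1 = 0 ↔ t ^ 6 + t ^ 3 + 1 = 0 := by
  have : (t + t⁻¹) ^ 3 - 3 * (t + t⁻¹) + 1 = (t ^ 6 + t ^ 3 + 1) / t ^ 3 := by
    field_simp; ring
  rw [this, div_eq_zero_iff]
  simp [ht0]

lemma pow_add_inv_eq_iff {F : Type*} [Field F] {t : F} (ht0 : t ≠ 0) {n : ℕ} (hn0 : n ≠ 0) :
    t ^ n + (t ^ n)⁻¹ = t + t⁻¹ ↔ t ^ (n - 1) = 1 ∨ t ^ (n + 1) = 1 := by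
  obtain ⟨n, rfl⟩ := Nat.exists_eq_succ_of_ne_zero hn0
  rw [Nat.succ_eq_add_one, Nat.add_sub_cancel]
  have hn := pow_ne_zero n ht0
  have : t ^ (n + 1) + (t ^ (n + 1))⁻¹ - (t + t⁻¹) =
      (t ^ n - 1) * (t ^ (n + 1 + 1) - 1) / (t ^ n * t) := by
    field_simp; ring
  rw [← sub_eq_zero, this, div_eq_zero_iff, mul_eq_zero, sub_eq_zero, sub_eq_zero]
  simp [ht0]

lemma exists_root_zmod {l : ℕ} (hl : l.Prime) (h : l % 9 = 1 ∨ l % 9 = 8) :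
    ∃ r : ZMod l, r ^ 3 - 3 * r + 1 = 0 := by
  have := Fact.mk hl
  let F := AlgebraicClosure (ZMod l)
  have h9 : ((9 : ℕ) : F) ≠ 0 := by
    intro h0
    have h1 := (CharP.cast_eq_zero_iff F l 9).mp h0
    have h2 : l ∣ 3 := hl.dvd_of_dvd_pow (show l ∣ 3 ^ 2 from h1)
    have h3 := (Nat.prime_dvd_prime_iff_eq hl Nat.prime_three).mp h2
    omega
  have : NeZero ((9 : ℕ) : F) := ⟨h9⟩
  obtain ⟨t, ht⟩ := HasEnoughRootsOfUnity.exists_primitiveRoot F 9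
  have ht0 : t ≠ 0 := ht.ne_zero (by norm_num)
  have h3 : IsPrimitiveRoot (t ^ 3) 3 := ht.pow (by norm_num) (by norm_num)
  have hs : t ^ 6 + t ^ 3 + 1 = 0 := by
    have := h3.geom_sum_eq_zero (by norm_num)
    simp only [Finset.sum_range_succ, Finset.sum_range_zero] at this
    linear_combination this
  have hfr : (t + t⁻¹) ^ l = t + t⁻¹ := by
    rw [add_pow_char, inv_pow, pow_add_inv_eq_iff ht0 hl.ne_zero]
    rw [ht.pow_eq_one_iff_dvd, ht.pow_eq_one_iff_dvd]
    omega
  obtain ⟨r, hr⟩ : ∃ r : ZMod l, algebraMap (ZMod l) F r = t + t⁻¹ := by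
    exact (bot_le : ⊥ ≤ (algebraMap (ZMod l) F).fieldRange)
      ((Subfield.mem_bot_iff_pow_eq_self F l).mpr hfr)
  refine ⟨r, (algebraMap (ZMod l) F).injective ?_⟩
  rw [map_add, map_sub, map_mul, map_pow, map_one, map_zero, hr, map_ofNat]
  exact (trace_root ht0).mpr hs

lemma orderOf_eq_nine {F : Type*} [Field F] (h3 : (3 : F) ≠ 0) {t : F}
    (ht : t ^ 6 + t ^ 3 + 1 = 0) : orderOf t = 9 := by
  apply orderOf_eq_prime_pow (p := 3) (n := 1)
  · intro h
    norm_num at h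
    apply h3
    linear_combination ht - (t ^ 3 + 2) * h
  · norm_num
    linear_combination (t ^ 3 - 1) * ht

lemma mod_nine_of_root {l : ℕ} (hl : l.Prime) (h3 : l ≠ 3) {r : ZMod l}
    (hr : r ^ 3 - 3 * r + 1 = 0) : l % 9 = 1 ∨ l % 9 = 8 := by
  have := Fact.mk hl
  let F := AlgebraicClosure (ZMod l)
  set R : F := algebraMap (ZMod l) F r with hR
  have hR3 : R ^ 3 - 3 * R + 1 = 0 := by
    have := congrArg (algebraMap (ZMod l) F) hr
    rwa [map_add, map_sub, map_mul, map_pow, map_one, map_zero, map_ofNat] at this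
  obtain ⟨t, ht⟩ : ∃ t : F, t ^ 2 - R * t + 1 = 0 := by
    obtain ⟨t, ht⟩ := IsAlgClosed.exists_root
      (Polynomial.X ^ 2 - Polynomial.C R * Polynomial.X + 1 : Polynomial F) (by
        have : (Polynomial.X ^ 2 - Polynomial.C R * Polynomial.X + 1 : Polynomial F).degree = 2 := by
          compute_degree!
        rw [this]; norm_num)
    exact ⟨t, by simpa [Polynomial.IsRoot] using ht⟩
  have ht0 : t ≠ 0 := by rintro rfl; simp at ht
  have hRt : R = t + t⁻¹ := by
    apply mul_right_cancel₀ ht0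
    rw [add_mul, inv_mul_cancel₀ ht0]
    linear_combination -ht
  have hs : t ^ 6 + t ^ 3 + 1 = 0 := by
    rwa [hRt, trace_root ht0] at hR3
  have h3F : (3 : F) ≠ 0 := by
    intro h0
    have h1 := (CharP.cast_eq_zero_iff F l 3).mp (by exact_mod_cast h0)
    exact h3 ((Nat.prime_dvd_prime_iff_eq hl Nat.prime_three).mp h1)
  have h9 := orderOf_eq_nine h3F hs
  have hfr : t ^ l + (t ^ l)⁻¹ = t + t⁻¹ := by
    rw [← inv_pow, ← add_pow_char, ← hRt, hR, ← map_pow, ZMod.pow_card]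
  rw [pow_add_inv_eq_iff ht0 hl.ne_zero, ← orderOf_dvd_iff_pow_eq_one,
    ← orderOf_dvd_iff_pow_eq_one, h9] at hfr
  have := hl.pos
  omega

lemma prime_dvd_binary {q : ℕ} (hq : q.Prime) (h3 : q ≠ 3) (h : ¬ (q % 9 = 1 ∨ q % 9 = 8))
    {a b : ℤ} (hab : (q : ℤ) ∣ a ^ 3 - 3 * a * b ^ 2 + b ^ 3) : (q : ℤ) ∣ a ∧ (q : ℤ) ∣ b := by
  have := Fact.mk hq
  simp only [← ZMod.intCast_zmod_eq_zero_iff_dvd] at *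
  push_cast at hab
  have hb : (b : ZMod q) = 0 := by
    by_contra hb
    apply h
    apply mod_nine_of_root hq h3 (r := a / b)
    field_simp
    linear_combination hab
  refine ⟨?_, hb⟩
  simpa [hb] using hab

/-- Thue's lemma modulo a prime. -/
lemma exists_abs_le_sqrt_eq_mul {l : ℕ} (hl : l.Prime) (r : ZMod l) :
    ∃ a b : ℤ, (a ≠ 0 ∨ b ≠ 0) ∧ |a| ≤ l.sqrt ∧ |b| ≤ l.sqrt ∧ (a : ZMod l) = r * b := by
  have := Fact.mk hl
  obtain ⟨⟨i, j⟩, ⟨i', j'⟩, hne, he⟩ := Fintype.exists_ne_map_eq_of_card_lt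
    (fun x : Fin (l.sqrt + 1) × Fin (l.sqrt + 1) =>
      ((x.1 : ℕ) : ZMod l) - r * ((x.2 : ℕ) : ZMod l))
    (by simpa [ZMod.card] using Nat.lt_succ_sqrt l)
  refine ⟨(i : ℤ) - i', (j : ℤ) - j', ?_, ?_, ?_, ?_⟩
  · by_contra! h
    apply hne
    ext <;> simp <;> omega
  · rw [abs_le]; omega
  · rw [abs_le]; omega
  · push_cast
    simp only at he
    linear_combination he

lemma abs_binary_le {a b s : ℤ} (ha : |a| ≤ s) (hb : |b| ≤ s) :
    |a ^ 3 - 3 * a * b ^ 2 + b ^ 3| ≤ 4 * s ^ 3 := by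
  have hs : 0 ≤ s := (abs_nonneg a).trans ha
  have ha2 : a ^ 2 ≤ s ^ 2 := sq_le_sq' (abs_le.mp ha).1 (abs_le.mp ha).2
  have hb2 : b ^ 2 ≤ s ^ 2 := sq_le_sq' (abs_le.mp hb).1 (abs_le.mp hb).2
  have h1 : |a ^ 2 - 3 * b ^ 2| ≤ 3 * s ^ 2 := by
    rw [abs_le]; constructor <;> nlinarith [sq_nonneg a, sq_nonneg b]
  calc |a ^ 3 - 3 * a * b ^ 2 + b ^ 3| = |a * (a ^ 2 - 3 * b ^ 2) + b ^ 3| := by ring_nf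
    _ ≤ |a| * |a ^ 2 - 3 * b ^ 2| + |b| ^ 3 := by
      rw [← abs_mul, ← abs_pow]; exact abs_add_le _ _
    _ ≤ s * (3 * s ^ 2) + s ^ 3 := by gcongr
    _ = 4 * s ^ 3 := by ring

lemma exists_isCoprime_dvd_binary {l : ℕ} (hl : l.Prime) (h : l % 9 = 1 ∨ l % 9 = 8) :
    ∃ a b : ℤ, IsCoprime a b ∧ (l : ℤ) ∣ a ^ 3 - 3 * a * b ^ 2 + b ^ 3 ∧
      |a ^ 3 - 3 * a * b ^ 2 + b ^ 3| < (l : ℤ) ^ 2 := by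
  have := Fact.mk hl
  obtain ⟨r, hr⟩ := exists_root_zmod hl h
  obtain ⟨a, b, h0, ha, hb, hab⟩ := exists_abs_le_sqrt_eq_mul hl r
  have hl17 : 17 ≤ l := by
    by_contra hc
    have := hl.two_le
    interval_cases l <;> revert hl h <;> norm_num
  have hs4 : 4 ≤ l.sqrt := Nat.le_sqrt.mpr (by omega)
  have hsl : l.sqrt * l.sqrt ≤ l := Nat.sqrt_le l
  have hlt : 4 * l.sqrt ^ 3 < l ^ 2 := by
    rcases hs4.eq_or_lt with h4 | h5
    · rw [← h4]; nlinarith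
    · nlinarith [Nat.pow_le_pow_left hsl 2, pow_pos (show 0 < l.sqrt by omega) 3]
  obtain ⟨g, a', b', hg, hcop, rfl, rfl⟩ : ∃ g a' b' : ℤ, 0 < g ∧ IsCoprime a' b' ∧
      a = a' * g ∧ b = b' * g := by
    have hg : 0 < Int.gcd a b := Int.gcd_pos_iff.mpr h0
    obtain ⟨a', b', hc, h1, h2⟩ := Int.exists_gcd_one hg
    exact ⟨Int.gcd a b, a', b', by exact_mod_cast hg, Int.isCoprime_iff_gcd_eq_one.mpr hc, h1, h2⟩
  have hle : ∀ {x : ℤ}, |x * g| ≤ l.sqrt → |x| ≤ l.sqrt := by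
    intro x hx
    rw [abs_mul, abs_of_pos hg] at hx
    nlinarith [abs_nonneg x]
  have hgl : (g : ZMod l) ≠ 0 := by
    intro hgz
    have hgd : (l : ℤ) ∣ g := (ZMod.intCast_zmod_eq_zero_iff_dvd _ _).mp hgz
    have hgle := Int.le_of_dvd hg hgd
    have hsq : (l.sqrt : ℤ) < l := by exact_mod_cast Nat.sqrt_lt_self hl.one_lt
    have key : ∀ x : ℤ, |x * g| ≤ l.sqrt → x = 0 := by
      intro x hx
      by_contra hx0
      rw [abs_mul, abs_of_pos hg] at hx
      nlinarith [Int.one_le_abs hx0]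
    rw [key _ ha, key _ hb] at h0
    simp at h0
  refine ⟨a', b', hcop, ?_, ?_⟩
  · rw [← ZMod.intCast_zmod_eq_zero_iff_dvd]
    push_cast at hab ⊢
    have : (a' : ZMod l) = r * b' := mul_right_cancel₀ hgl (by linear_combination hab)
    rw [this]
    linear_combination (b' : ZMod l) ^ 3 * hr
  · refine (abs_binary_le (hle ha) (hle hb)).trans_lt ?_
    exact_mod_cast hlt

section Representation

variable {K : Type*} [Field K]

lemma cubicForm_binary {w : K} (hw : w ^ 2 + w + 1 = 0) (a b : K) :
    cubicForm w a (-b) (-(w ^ 2 * b)) = a ^ 3 - 3 * a * b ^ 2 + b ^ 3 := by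
  have : w ^ 3 = 1 := by linear_combination (w - 1) * hw
  simp only [cubicForm]
  linear_combination (-b ^ 3 * w ^ 2 * (w ^ 3 + 1) - 3 * a * b ^ 2) * this - b ^ 3 * hw

/-- `n` is represented by the norm form of `K[X] / (X ^ 3 - w)`. -/
def IsRep (w n : K) : Prop := ∃ x y z, cubicForm w x y z = n

lemma IsRep.mul {w m n : K} (hm : IsRep w m) (hn : IsRep w n) : IsRep w (m * n) := by
  obtain ⟨x, y, z, rfl⟩ := hm
  obtain ⟨x', y', z', rfl⟩ := hn
  exact ⟨_, _, _, (cubicForm_mul ..).symm⟩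

lemma isRep_cube (w n : K) : IsRep w (n ^ 3) := ⟨n, 0, 0, by simp [cubicForm]⟩

lemma IsRep.inv {w n : K} (h : IsRep w n) : IsRep w n⁻¹ := by
  by_cases hn : n = 0
  · simpa [hn] using h
  · convert (h.mul h).mul (isRep_cube w n⁻¹) using 1
    field_simp

lemma IsRep.of_primes {w : K} {n : ℕ} (hn : n ≠ 0)
    (h : ∀ p : ℕ, p.Prime → p ∣ n → IsRep w (p : K)) : IsRep w (n : K) := by
  induction n using Nat.recOnMul with
  | zero => exact absurd rfl hn
  | one => simpa using isRep_cube w (1 : K)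
  | prime p hp => exact h p hp dvd_rfl
  | mul a b iha ihb =>
    rw [Nat.cast_mul]
    exact (iha (by rintro rfl; simp at hn) fun p hp hd => h p hp (hd.mul_right b)).mul
      (ihb (by rintro rfl; simp at hn) fun p hp hd => h p hp (hd.mul_left a))

lemma isRep_prime [CharZero K] {w : K} (hw : w ^ 2 + w + 1 = 0) (l : ℕ) (hl : l.Prime)
    (h : l ≠ 3 → l % 9 = 1 ∨ l % 9 = 8) : IsRep w (l : K) := by
  induction l using Nat.strong_induction_on with
  | _ l ih =>
  by_cases h3 : l = 3
  · subst h3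
    exact ⟨_, _, _, (cubicForm_binary hw (-1) 1).trans (by norm_num)⟩
  obtain ⟨a, b, hab, hdvd, hlt⟩ := exists_isCoprime_dvd_binary hl (h h3)
  set f := a ^ 3 - 3 * a * b ^ 2 + b ^ 3 with hf
  have hprime : ∀ q : ℕ, q.Prime → (q : ℤ) ∣ f → q ≠ 3 → q % 9 = 1 ∨ q % 9 = 8 := by
    intro q hq hqf hq3
    by_contra hc
    obtain ⟨h1, h2⟩ := prime_dvd_binary hq hq3 hc hqf
    exact (Nat.prime_iff_prime_int.mp hq).not_isUnit (hab.isUnit_of_dvd' h1 h2)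
  have hf0 : f ≠ 0 := by
    intro h0
    have := hprime 2 Nat.prime_two (by simp [h0])
    omega
  have hfrep : IsRep w (f : K) :=
    ⟨_, _, _, (cubicForm_binary hw (a : K) b).trans (by rw [hf]; push_cast; ring)⟩
  have hnrep : IsRep w (f.natAbs : K) := by
    rcases Int.natAbs_eq f with e | e
    · rwa [e, Int.cast_natCast] at hfrep
    · have := hfrep.mul (isRep_cube w (-1))
      rw [e] at this
      push_cast at this
      simpa [Odd.neg_one_pow (by decide : Odd 3)] using this
  obtain ⟨k, hk⟩ := Int.natCast_dvd.mp hdvd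
  have hk0 : k ≠ 0 := by rintro rfl; simp at hk; exact hf0 hk
  have hkl : k < l := by
    have : l * k < l ^ 2 := by
      rw [← hk]; zify; exact hlt
    nlinarith
  have hkrep : IsRep w (k : K) := by
    refine IsRep.of_primes hk0 fun p hp hpk => ?_
    refine ih p ((Nat.le_of_dvd (Nat.pos_of_ne_zero hk0) hpk).trans_lt hkl) hp ?_
    refine hprime p hp (Int.natCast_dvd.mpr ?_)
    rw [hk]; exact hpk.mul_left l
  have := hnrep.mul hkrep.inv
  rw [hk] at this
  have hkK : (k : K) ≠ 0 := by exact_mod_cast hk0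
  push_cast at this
  rwa [mul_assoc, mul_inv_cancel₀ hkK, mul_one] at this

/-- If the cyclic algebra generated by `X` and `Y` with `X ^ 3 = a`, `Y ^ 3 = b` and
`Y X = w X Y` acts on a space of dimension three, then `a` is represented by the norm form
of `b`. -/
lemma isRep_of_semicommuting {V : Type*} [AddCommGroup V] [Module K V]
    (hV : Module.finrank K V = 3) {w a b : K} (hw : w ^ 2 + w + 1 = 0) {X Y : Module.End K V}
    (hX : ∀ v, X (X (X v)) = a • v) (hY : ∀ v, Y (Y (Y v)) = b • v)
    (hYX : ∀ v, Y (X v) = w • X (Y v))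
    (hb : ∀ p q r : K, cubicForm b p q r = 0 → p = 0 ∧ q = 0 ∧ r = 0) : IsRep b a := by
  have : Nontrivial V := Module.nontrivial_of_finrank_pos (R := K) (by omega)
  obtain ⟨v, hv⟩ := exists_ne (0 : V)
  have hw3 : w ^ 3 = 1 := by linear_combination (w - 1) * hw
  have hXY : ∀ u, X (Y u) = w ^ 2 • Y (X u) := by
    intro u
    rw [hYX, smul_smul, ← pow_succ, hw3, one_smul]
  have hli : LinearIndependent K ![v, Y v, Y (Y v)] := by
    rw [Fintype.linearIndependent_iff]
    intro g hg
    simp only [Fin.sum_univ_three, Matrix.cons_val] at hg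
    have hg1 := congrArg Y hg
    have hg2 := congrArg (fun u => Y (Y u)) hg
    simp only [map_add, map_smul, hY, map_zero] at hg1 hg2
    have hN : cubicForm b (g 0) (g 1) (g 2) • v = 0 := by
      have : cubicForm b (g 0) (g 1) (g 2) • v =
          (g 0 ^ 2 - b * g 1 * g 2) • (g 0 • v + g 1 • Y v + g 2 • Y (Y v)) +
          (b * g 2 ^ 2 - g 0 * g 1) • (g 0 • Y v + g 1 • Y (Y v) + g 2 • b • v) +
          (g 1 ^ 2 - g 0 * g 2) • (g 0 • Y (Y v) + g 1 • b • v + g 2 • b • Y v) := by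
        rw [cubicForm]; module
      rw [this, hg, hg1, hg2]; simp
    obtain ⟨h0, h1, h2⟩ := hb _ _ _ ((smul_eq_zero.mp hN).resolve_right hv)
    intro i; fin_cases i <;> assumption
  have hsp : Submodule.span K (Set.range ![v, Y v, Y (Y v)]) = ⊤ :=
    hli.span_eq_top_of_card_eq_finrank (by simp [hV])
  obtain ⟨c, hc⟩ :=
    (Submodule.mem_span_range_iff_exists_fun K).mp (hsp ▸ Submodule.mem_top (x := X v))
  simp only [Fin.sum_univ_three, Matrix.cons_val] at hc
  refine ⟨c 0, c 1, c 2, ?_⟩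
  have h := hX v
  rw [← hc] at h
  simp only [map_add, map_smul, hXY] at h
  rw [← hc] at h
  simp only [map_add, map_smul, hXY, hY] at h
  rw [← hc] at h
  simp only [map_add, map_smul, hY] at h
  have : (cubicForm b (c 0) (c 1) (c 2) - a) • v = 0 := by
    rw [sub_smul, ← h, cubicForm]
    match_scalars <;> grind
  simpa [sub_eq_zero, hv] using this

lemma IsRep.swap {w b : K} (hw : w ^ 2 + w + 1 = 0)
    (hb : ∀ p q r : K, cubicForm b p q r = 0 → p = 0 ∧ q = 0 ∧ r = 0) (h : IsRep w b) :
    IsRep b w := by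
  obtain ⟨x, y, z, rfl⟩ := h
  have hw3 : w ^ 3 = 1 := by linear_combination (w - 1) * hw
  refine isRep_of_semicommuting (V := Fin 3 → K) (by simp) hw
    (X := Matrix.toLin' !![0, 0, w; 1, 0, 0; 0, 1, 0])
    (Y := Matrix.toLin' !![x, w * (w * z), w * (w ^ 2 * y); y, w * x, w * (w ^ 2 * z);
      z, w * y, w ^ 2 * x])
    ?_ ?_ ?_ hb
  · intro v
    ext i; fin_cases i <;> simp [Matrix.mulVec, dotProduct, Fin.sum_univ_three, mul_comm]
  · intro v
    ext i; fin_cases i <;> simp [Matrix.mulVec, dotProduct, Fin.sum_univ_three, cubicForm] <;> grind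
  · intro v
    ext i; fin_cases i <;> simp [Matrix.mulVec, dotProduct, Fin.sum_univ_three] <;> grind

variable {L : Type*} [Field L] [Algebra K L]

lemma norm_eq_cubicForm {b : K} {β : L} (hβ : β ^ 3 = algebraMap K L b)
    (e : Module.Basis (Fin 3) K L) (he : ⇑e = ![1, β, β ^ 2]) (p q r : K) :
    Algebra.norm K (p • 1 + q • β + r • β ^ 2) = cubicForm b p q r := by
  have h0 : e 0 = 1 := by simp [he]
  have h1 : e 1 = β := by simp [he]
  have h2 : e 2 = β ^ 2 := by simp [he]
  have m0 : (p • 1 + q • β + r • β ^ 2) * e 0 = p • e 0 + q • e 1 + r • e 2 := by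
    rw [h0, h1, h2, mul_one]
  have m1 : (p • 1 + q • β + r • β ^ 2) * e 1 = (b * r) • e 0 + p • e 1 + q • e 2 := by
    simp only [h0, h1, h2, Algebra.smul_def, map_mul, ← hβ]; ring
  have m2 : (p • 1 + q • β + r • β ^ 2) * e 2 = (b * q) • e 0 + (b * r) • e 1 + p • e 2 := by
    simp only [h0, h1, h2, Algebra.smul_def, map_mul, ← hβ]; ring
  rw [Algebra.norm_eq_matrix_det e, Matrix.det_fin_three]
  simp only [Algebra.leftMulMatrix_eq_repr_mul, m0, m1, m2]
  simp [cubicForm]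
  ring

lemma exists_basis {b : K} (hb : ∀ c : K, c ^ 3 ≠ b) {β : L} (hβ : β ^ 3 = algebraMap K L b)
    (htop : K⟮β⟯ = ⊤) : ∃ e : Module.Basis (Fin 3) K L, ⇑e = ![1, β, β ^ 2] := by
  have hirr := X_pow_sub_C_irreducible_of_prime Nat.prime_three hb
  have hmin : minpoly K β = Polynomial.X ^ 3 - Polynomial.C b :=
    (minpoly.eq_of_irreducible_of_monic hirr (by simp [hβ])
      (Polynomial.monic_X_pow_sub_C _ (by norm_num))).symm
  have hdeg : (minpoly K β).natDegree = 3 := by rw [hmin]; exact Polynomial.natDegree_X_pow_sub_C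
  have hint : IsIntegral K β := by
    by_contra h
    rw [minpoly.eq_zero h] at hdeg
    simp at hdeg
  have hfin : Module.finrank K L = 3 := by
    rw [← finrank_top', ← htop, adjoin.finrank hint, hdeg]
  have hli : LinearIndependent K ![1, β, β ^ 2] := by
    have := (linearIndependent_pow (K := K) β).comp
      (finCongr hdeg.symm) (finCongr hdeg.symm).injective
    convert this using 1
    ext i; fin_cases i <;> simp
  exact ⟨basisOfLinearIndependentOfCardEqFinrank hli (by simp [hfin]), by simp⟩

lemma exists_norm_eq_iff_isRep {b : K} {β : L} (hβ : β ^ 3 = algebraMap K L b)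
    (e : Module.Basis (Fin 3) K L) (he : ⇑e = ![1, β, β ^ 2]) (a : K) :
    (∃ Z : L, Algebra.norm K Z = a) ↔ IsRep b a := by
  constructor
  · rintro ⟨Z, rfl⟩
    have := e.sum_repr Z
    simp only [Fin.sum_univ_three, he, Matrix.cons_val] at this
    rw [← this, norm_eq_cubicForm hβ e he]
    exact ⟨_, _, _, rfl⟩
  · rintro ⟨x, y, z, rfl⟩
    exact ⟨_, norm_eq_cubicForm hβ e he x y z⟩

lemma cubicForm_eq_zero {b : K} {β : L} (hβ : β ^ 3 = algebraMap K L b)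
    (e : Module.Basis (Fin 3) K L) (he : ⇑e = ![1, β, β ^ 2]) (p q r : K)
    (h : cubicForm b p q r = 0) : p = 0 ∧ q = 0 ∧ r = 0 := by
  have := Module.Finite.of_basis e
  rw [← norm_eq_cubicForm hβ e he, Algebra.norm_eq_zero_iff] at h
  have hli := Fintype.linearIndependent_iff.mp e.linearIndependent ![p, q, r]
    (by simpa [Fin.sum_univ_three, he] using h)
  exact ⟨hli 0, hli 1, hli 2⟩
end Representation

lemma eq_one_of_pow_three_eq_one {Γ : Type*} [LinearOrderedCommGroupWithZero Γ] {g : Γ}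
    (h : g ^ 3 = 1) : g = 1 :=
  (pow_left_inj₀ zero_le zero_le three_ne_zero).mp (h.trans (one_pow 3).symm)

section Valuation

variable {K : Type*} [Field K] {Γ : Type*} [LinearOrderedCommGroupWithZero Γ] (v : Valuation K Γ)

lemma map_sub_lt_of_dominant {A B C T : K} (hB : v B < v A) (hC : v C < v A)
    (hT : v T ^ 3 ≤ v A * v B * v C) : v (A + B + C - T - A) < v A := by
  have hA : 0 < v A := zero_le.trans_lt hB
  have hTA : v T < v A := by
    refine lt_of_pow_lt_pow_left₀ 3 zero_le (hT.trans_lt ?_)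
    rw [pow_three, mul_assoc]
    exact mul_lt_mul_of_pos_left (mul_lt_mul'' hB hC zero_le zero_le) hA
  rw [show A + B + C - T - A = B + C - T by ring]
  exact v.map_sub_lt (v.map_add_lt hB hC) hTA

lemma map_cube_sub_lt_one {d p q r z : K} (hd : ∀ g : K, v d * v g ^ 3 ≠ 1) (h3 : v 3 ≤ 1)
    (hz : v z = 1) (h : cubicForm d p q r = z) : v (p ^ 3 - z) < 1 := by
  have hz0 : z ≠ 0 := by rw [← v.ne_zero_iff, hz]; exact one_ne_zero
  have hd1 : ∀ x y : K, y ≠ 0 → v (d * x ^ 3) ≠ v (y ^ 3) := by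
    intro x y hy he
    apply hd (x / y)
    rw [← map_pow, ← map_mul, div_pow, mul_div_assoc', map_div₀, he, div_self]
    simpa using hy
  have hd2 : ∀ x y : K, y ≠ 0 → v (d ^ 2 * x ^ 3) ≠ v (y ^ 3) := by
    intro x y hy he
    have hx : d ^ 2 * x ^ 3 ≠ 0 := by
      rw [← v.ne_zero_iff, he, v.ne_zero_iff]; exact pow_ne_zero 3 hy
    have hd0 : d ≠ 0 := by rintro rfl; simp at hx
    have hx0 : x ≠ 0 := by rintro rfl; simp at hx
    apply hd1 y (d * x) (mul_ne_zero hd0 hx0)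
    rw [map_mul, ← he, ← map_mul]
    ring_nf
  have hT : v (3 * d * p * q * r) ^ 3 ≤ v (p ^ 3) * v (d * q ^ 3) * v (d ^ 2 * r ^ 3) := by
    rw [← map_pow, ← map_mul, ← map_mul, show (3 * d * p * q * r) ^ 3 =
      3 ^ 3 * (p ^ 3 * (d * q ^ 3) * (d ^ 2 * r ^ 3)) by ring, map_mul, map_pow]
    exact mul_le_of_le_one_left' (pow_le_one' h3 3)
  have key : ∀ {x}, v (z - x) < v x → v x = 1 := fun hx => by
    rw [← hz, Valuation.map_eq_of_sub_lt v hx]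
  rw [cubicForm] at h
  by_cases hA : v (d * q ^ 3) ≤ v (p ^ 3) ∧ v (d ^ 2 * r ^ 3) ≤ v (p ^ 3)
  · have hp : p ≠ 0 := by
      rintro rfl
      have h0 : v ((0 : K) ^ 3) = 0 := by simp
      rw [h0, le_zero_iff, le_zero_iff, v.zero_iff, v.zero_iff] at hA
      apply hz0
      rw [← h, hA.1, hA.2]
      ring
    have hlt := map_sub_lt_of_dominant v (hA.1.lt_of_ne (hd1 q p hp))
      (hA.2.lt_of_ne (hd2 r p hp)) hT
    rw [h] at hlt
    rw [Valuation.map_sub_swap]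
    exact hlt.trans_eq (key hlt)
  by_cases hB : v (d ^ 2 * r ^ 3) ≤ v (d * q ^ 3)
  · have hAB : v (p ^ 3) < v (d * q ^ 3) := lt_of_not_ge fun h' => hA ⟨h', hB.trans h'⟩
    have hdq : d * q ^ 3 ≠ 0 := v.ne_zero_iff.mp (zero_le.trans_lt hAB).ne'
    have hCB : v (d ^ 2 * r ^ 3) ≠ v (d * q ^ 3) := by
      intro he
      rw [pow_two, mul_assoc, map_mul, map_mul v d (q ^ 3)] at he
      exact hd1 r q (by rintro rfl; simp at hdq)
        (mul_left_cancel₀ (v.ne_zero_iff.mpr (left_ne_zero_of_mul hdq)) he)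
    have hlt := map_sub_lt_of_dominant v hAB (hB.lt_of_ne hCB) (hT.trans_eq (by ac_rfl))
    rw [add_comm (d * q ^ 3) (p ^ 3), h] at hlt
    have := key hlt
    rw [map_mul, map_pow] at this
    exact (hd q this).elim
  · rw [not_le] at hB
    have hAC : v (p ^ 3) < v (d ^ 2 * r ^ 3) := lt_of_not_ge fun h' => hA ⟨hB.le.trans h', h'⟩
    have hlt := map_sub_lt_of_dominant v hAC hB (hT.trans_eq (by ac_rfl))
    rw [show d ^ 2 * r ^ 3 + p ^ 3 + d * q ^ 3 = p ^ 3 + d * q ^ 3 + d ^ 2 * r ^ 3 by ring,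
      h] at hlt
    exact (hd2 r 1 one_ne_zero (by rw [key hlt]; simp)).elim
end Valuation

lemma mod_nine_of_isRep {K : Type*} [Field K] [NumberField K] (hK : Module.finrank ℚ K = 2) {z : K}
    (hz : z ^ 2 + z + 1 = 0) {d l : ℕ} (hl : l.Prime) (hl3 : l ≠ 3) (hld : l ∣ d)
    (hld3 : ¬ l ^ 3 ∣ d) (h : IsRep (d : K) z) : l % 9 = 1 ∨ l % 9 = 8 := by
  obtain ⟨p, q, r, hpqr⟩ := h
  have hl0 : (l : 𝓞 K) ≠ 0 := by exact_mod_cast hl.ne_zero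
  have hnorm : Ideal.absNorm (Ideal.span {(l : 𝓞 K)}) = l ^ 2 := by
    rw [Ideal.absNorm_span_natCast, RingOfIntegers.rank, hK]
  obtain ⟨M, hM, hlM⟩ := Ideal.exists_le_maximal (Ideal.span {(l : 𝓞 K)}) (by
    intro h
    rw [h, Ideal.absNorm_top] at hnorm
    nlinarith [hl.two_le])
  have hlM' : (l : 𝓞 K) ∈ M := hlM (Ideal.mem_span_singleton_self _)
  let P : IsDedekindDomain.HeightOneSpectrum (𝓞 K) :=
    ⟨M, hM.isPrime, by rintro rfl; exact hl0 (by simpa using hlM')⟩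
  set v := P.valuation K with hv
  obtain ⟨f, hf2, hf⟩ := (Nat.dvd_prime_pow hl).mp (hnorm ▸ Ideal.absNorm_dvd_absNorm_of_le hlM)
  have hf0 : f ≠ 0 := by
    rintro rfl
    rw [pow_zero, Ideal.absNorm_eq_one_iff] at hf
    exact hM.ne_top hf
  have hvl : v l = WithZero.exp (-1) ∨ v l = WithZero.exp (-2) := by
    have h0 : v (l : K) ≠ 0 := by
      rw [v.ne_zero_iff]; exact_mod_cast hl.ne_zero
    have h1 : v (algebraMap (𝓞 K) K l) < 1 := by
      rw [hv, P.valuation_lt_one_iff_mem]; exact hlM'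
    have h2 : ¬ v (algebraMap (𝓞 K) K l) ≤ WithZero.exp (-((3 : ℕ) : ℤ)) := by
      rw [hv, P.valuation_of_algebraMap, P.intValuation_le_pow_iff_dvd]
      intro hdvd
      have := Ideal.absNorm_dvd_absNorm_of_le (Ideal.le_of_dvd hdvd)
      rw [hnorm, map_pow, hf, ← pow_mul, Nat.pow_dvd_pow_iff_le_right hl.one_lt] at this
      omega
    rw [map_natCast] at h1 h2
    rw [← WithZero.exp_log h0] at h1 h2 ⊢
    rw [WithZero.exp_inj, WithZero.exp_inj]
    rw [← WithZero.exp_zero, WithZero.exp_lt_exp] at h1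
    rw [WithZero.exp_le_exp] at h2
    omega
  have hvcop : ∀ m : ℕ, ¬ l ∣ m → (m : 𝓞 K) ∉ M := by
    intro m hm hmM
    have hc : IsCoprime (l : ℤ) m :=
      Nat.isCoprime_iff_coprime.mpr ((Nat.Prime.coprime_iff_not_dvd hl).mpr hm)
    obtain ⟨a, b, hab⟩ := hc
    apply hM.ne_top
    rw [Ideal.eq_top_iff_one]
    have : (a : 𝓞 K) * l + b * m = 1 := by exact_mod_cast congrArg (Int.cast : ℤ → 𝓞 K) hab
    rw [← this]
    exact M.add_mem (M.mul_mem_left _ hlM') (M.mul_mem_left _ hmM)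
  have hvd : ∀ g : K, v d * v g ^ 3 ≠ 1 := by
    intro g hg
    have hg0 : v g ≠ 0 := by rintro h0; simp [h0] at hg
    obtain ⟨m, rfl⟩ := hld
    have hval1 : ∀ n : ℕ, ¬ l ∣ n → v (n : K) = 1 := by
      intro n hn
      have := (P.valuation_eq_one_iff_notMem (K := K)).mpr (hvcop n hn)
      rwa [map_natCast] at this
    have hvm : v (m : K) = 1 ∨ v (m : K) = v (l : K) := by
      by_cases hm : l ∣ m
      · obtain ⟨n, rfl⟩ := hm
        right
        rw [Nat.cast_mul, map_mul, hval1 n, mul_one]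
        rintro ⟨k, rfl⟩
        exact hld3 ⟨k, by ring⟩
      · exact Or.inl (hval1 m hm)
    rw [Nat.cast_mul, map_mul, ← WithZero.exp_log hg0] at hg
    rcases hvl with e | e <;> rcases hvm with e' | e' <;> rw [e'] at hg <;> rw [e] at hg <;>
    · simp only [← WithZero.exp_add, ← WithZero.exp_nsmul, ← WithZero.exp_zero,
        WithZero.exp_inj] at hg
      simp at hg
      omega
  have hz3 : z ^ 3 = 1 := by linear_combination (z - 1) * hz
  have hvz : v z = 1 := by
    have := congrArg v hz3
    rw [map_pow, map_one] at this
    exact eq_one_of_pow_three_eq_one this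
  have h3v : v 3 ≤ 1 := by
    calc v 3 = v (algebraMap (𝓞 K) K 3) := congrArg v (map_ofNat (algebraMap (𝓞 K) K) 3).symm
      _ ≤ 1 := P.valuation_le_one 3
  have hlt := map_cube_sub_lt_one v hvd h3v hvz hpqr
  have hvp : v p ≤ 1 := by
    rw [← hvz] at hlt
    have := Valuation.map_eq_of_sub_lt v hlt
    rw [map_pow, hvz] at this
    exact (eq_one_of_pow_three_eq_one this).le
  obtain ⟨a, ha⟩ := P.exists_valuation_sub_lt_of_integer hvp 1
  let zO : 𝓞 K := ⟨z, Polynomial.X ^ 3 - 1, by monicity!, by simp [hz3]⟩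
  have hzO : zO ^ 2 + zO + 1 = 0 := RingOfIntegers.ext hz
  have hmem : a ^ 3 - zO ∈ M := by
    change a ^ 3 - zO ∈ P.asIdeal
    rw [← P.valuation_lt_one_iff_mem (K := K), ← hv]
    have : algebraMap (𝓞 K) K (a ^ 3 - zO) = (a - p) * (a ^ 2 + a * p + p ^ 2) + (p ^ 3 - z) := by
      change (a : K) ^ 3 - z = _
      ring
    change v (algebraMap (𝓞 K) K (a ^ 3 - zO)) < 1
    rw [this]
    refine v.map_add_lt ?_ hlt
    rw [map_mul]
    refine mul_lt_one_of_lt_of_le ha ?_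
    have hva : v a ≤ 1 := P.valuation_le_one a
    refine v.map_add_le (v.map_add_le ?_ ?_) ?_
    · rw [map_pow]; exact pow_le_one' hva 2
    · rw [map_mul]; exact mul_le_one' hva hvp
    · rw [map_pow]; exact pow_le_one' hvp 2
  let k := 𝓞 K ⧸ M
  let _ : Field k := Ideal.Quotient.field M
  have hcard : Nat.card k = l ^ f := hf
  have : Finite k := Nat.finite_of_card_ne_zero (hcard ▸ pow_ne_zero f hl.ne_zero)
  let _ := Fintype.ofFinite k
  have h3k : (3 : k) ≠ 0 := by
    have := hvcop 3 (fun h => hl3 ((Nat.prime_dvd_prime_iff_eq hl Nat.prime_three).mp h))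
    rwa [← Ideal.Quotient.eq_zero_iff_mem, map_natCast] at this
  set t : k := Ideal.Quotient.mk M a with ht
  have ht3 : t ^ 3 = Ideal.Quotient.mk M zO := by
    rw [ht, ← map_pow]
    exact Ideal.Quotient.eq.mpr hmem
  have ht6 : t ^ 6 + t ^ 3 + 1 = 0 := by
    rw [show t ^ 6 = (t ^ 3) ^ 2 by ring, ht3, ← map_pow, ← map_add,
      ← map_one (Ideal.Quotient.mk M), ← map_add, hzO, map_zero]
  have h9 := orderOf_eq_nine h3k ht6
  have ht0 : t ≠ 0 := by rintro h0; rw [h0] at ht6; simp at ht6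
  have hdvd : 9 ∣ l ^ f - 1 := by
    rw [← h9, ← hcard, Nat.card_eq_fintype_card]
    exact orderOf_dvd_of_pow_eq_one (FiniteField.pow_card_sub_one_eq_one t ht0)
  have hmod : l ^ f % 9 = 1 := by
    have := pow_pos hl.pos f
    omega
  have hlt9 := Nat.mod_lt l (show 9 > 0 by norm_num)
  rw [Nat.pow_mod] at hmod
  interval_cases f <;> interval_cases l % 9 <;> simp_all

section PureCubic

variable (d : ℕ)

lemma zetaK_isPrimitiveRoot : IsPrimitiveRoot (zetaK d) 3 :=
  (IsPrimitiveRoot.coe_submonoidClass_iff (M := ℂ)).mp zeta3_isPrimitiveRoot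

lemma zetaK0_isPrimitiveRoot : IsPrimitiveRoot (zetaK0 d) 3 :=
  IsPrimitiveRoot.coe_submonoidClass_iff.mp (zetaK_isPrimitiveRoot d)

lemma zetaK0_sq_add : zetaK0 d ^ 2 + zetaK0 d + 1 = 0 := by
  have h := (zetaK0_isPrimitiveRoot d).geom_sum_eq_zero (by norm_num)
  simp only [Finset.sum_range_succ, Finset.sum_range_zero] at h
  linear_combination h

lemma finrank_k0S : Module.finrank ℚ (k0S d) = 2 := by
  have : IsCyclotomicExtension {3} ℚ (k0S d) :=
    (zetaK_isPrimitiveRoot d).intermediateField_adjoin_isCyclotomicExtension ℚ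
  rw [IsCyclotomicExtension.Rat.finrank 3 (k0S d), Nat.totient_prime Nat.prime_three]

lemma cbrtK_pow_three : cbrtK d ^ 3 = algebraMap (k0S d) (Kc d) d := by
  rw [map_natCast]
  exact Subtype.ext (cbrt_pow_three d)

lemma adjoin_cbrtK : (k0S d)⟮cbrtK d⟯ = ⊤ := by
  rw [eq_top_iff]
  rintro ⟨x, hx⟩ -
  induction hx using IntermediateField.adjoin_induction with
  | mem x hx =>
    rcases hx with rfl | rfl
    · exact mem_adjoin_simple_self (k0S d) (cbrtK d)
    · exact _root_.algebraMap_mem (k0S d)⟮cbrtK d⟯ (zetaK0 d)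
  | algebraMap q => exact _root_.algebraMap_mem (k0S d)⟮cbrtK d⟯ (algebraMap ℚ (k0S d) q)
  | add x y _ _ hx hy => exact add_mem hx hy
  | inv x _ hx => exact inv_mem hx
  | mul x y _ _ hx hy => exact mul_mem hx hy

variable {d}

lemma IsCubeFree.rat_pow_three_ne (hd : 1 < d) (hdcf : IsCubeFree d) (c : ℚ) : c ^ 3 ≠ d := by
  intro h
  have hc : IsIntegral ℤ c := by
    refine IsIntegral.of_pow (n := 3) (by norm_num) ?_
    rw [h]
    exact isIntegral_algebraMap (x := (d : ℤ))
  obtain ⟨n, rfl⟩ := IsIntegrallyClosed.isIntegral_iff.mp hc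
  have hn : n ^ 3 = d := by
    rw [eq_intCast] at h
    exact_mod_cast h
  have hn' : n.natAbs ^ 3 = d := by
    rw [← Int.natAbs_pow, hn, Int.natAbs_natCast]
  have h1 : n.natAbs ≠ 1 := by
    intro h1
    rw [h1] at hn'
    omega
  obtain ⟨p, hp, hpn⟩ := Nat.exists_prime_and_dvd h1
  exact hdcf p hp (hn' ▸ pow_dvd_pow_of_dvd hpn 3)

lemma IsCubeFree.k0S_pow_three_ne (hd : 1 < d) (hdcf : IsCubeFree d) (c : k0S d) :
    c ^ 3 ≠ d := by
  intro h
  have hN : Algebra.norm ℚ c ^ 3 = (d : ℚ) ^ 2 := by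
    rw [← map_pow, h, ← map_natCast (algebraMap ℚ (k0S d)), Algebra.norm_algebraMap, finrank_k0S]
  have hd0 : (d : ℚ) ≠ 0 := by exact_mod_cast (by omega : d ≠ 0)
  apply hdcf.rat_pow_three_ne hd (d / Algebra.norm ℚ c)
  rw [div_pow, hN]
  field_simp

lemma zetaK0_isRep_iff (hd : 1 < d) (hdcf : IsCubeFree d) :
    IsRep (d : k0S d) (zetaK0 d) ↔
      ∀ ℓ : ℕ, ℓ.Prime → ℓ ∣ d → ℓ ≠ 3 → ℓ % 9 = 1 ∨ ℓ % 9 = 8 := by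
  constructor
  · intro h l hl hld hl3
    exact mod_nine_of_isRep (finrank_k0S d) (zetaK0_sq_add d) hl hl3 hld (hdcf l hl) h
  · intro h
    obtain ⟨e, he⟩ := exists_basis (hdcf.k0S_pow_three_ne hd) (cbrtK_pow_three d) (adjoin_cbrtK d)
    refine IsRep.swap (zetaK0_sq_add d) (cubicForm_eq_zero (cbrtK_pow_three d) e he) ?_
    exact IsRep.of_primes (by omega) fun p hp hpd =>
      isRep_prime (zetaK0_sq_add d) p hp (h p hp hpd)

lemma exists_norm_eq_zetaK0_iff (hd : 1 < d) (hdcf : IsCubeFree d) :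
    (∃ Z : Kc d, Algebra.norm (k0S d) Z = zetaK0 d) ↔
      ∀ ℓ : ℕ, ℓ.Prime → ℓ ∣ d → ℓ ≠ 3 → ℓ % 9 = 1 ∨ ℓ % 9 = 8 := by
  obtain ⟨e, he⟩ := exists_basis (hdcf.k0S_pow_three_ne hd) (cbrtK_pow_three d) (adjoin_cbrtK d)
  rw [exists_norm_eq_iff_isRep (cbrtK_pow_three d) e he, zetaK0_isRep_iff hd hdcf]

end PureCubic

/-- `ζ₃` is a relative norm from `k = ℚ(∛d, ζ₃)` over `k₀ = ℚ(ζ₃)` if and only if every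
prime divisor `ℓ ≠ 3` of `d` satisfies `ℓ ≡ ±1 (mod 9)`; in particular this condition is
necessary for `ζ₃` to be the norm of a unit of `𝓞_k`. -/
theorem zeta_is_norm_iff
    (d : ℕ) (hd : 1 < d) (hdcf : IsCubeFree d) :
    ((∃ Z : ↥(Kc d), Z ≠ 0 ∧ Algebra.norm ↥(k0S d) Z = zetaK0 d) ↔
      (∀ ℓ : ℕ, ℓ.Prime → ℓ ∣ d → ℓ ≠ 3 → ℓ % 9 = 1 ∨ ℓ % 9 = 8)) ∧
    ((∃ v : (𝓞 ↥(Kc d))ˣ,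
        Algebra.norm ↥(k0S d) ((v : 𝓞 ↥(Kc d)) : ↥(Kc d)) = zetaK0 d) →
      (∀ ℓ : ℕ, ℓ.Prime → ℓ ∣ d → ℓ ≠ 3 → ℓ % 9 = 1 ∨ ℓ % 9 = 8)) := by
  refine ⟨⟨fun ⟨Z, _, hZ⟩ => (exists_norm_eq_zetaK0_iff hd hdcf).mp ⟨Z, hZ⟩, fun h => ?_⟩,
    fun ⟨v, hv⟩ => (exists_norm_eq_zetaK0_iff hd hdcf).mp ⟨_, hv⟩⟩
  obtain ⟨Z, hZ⟩ := (exists_norm_eq_zetaK0_iff hd hdcf).mpr h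
  refine ⟨Z, ?_, hZ⟩
  have := Module.Finite.right ℚ (k0S d) (Kc d)
  rintro rfl
  rw [Algebra.norm_zero] at hZ
  exact (zetaK0_isPrimitiveRoot d).ne_zero (by norm_num) hZ.symm

end
end
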